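/- Let k ≥ 1 and r > 5 be integers and let H be a graph on r vertices with pathwidth at most 2. If a graph G satisfies tw(G) ≥ k^2 · log(2k) · (180 · 2^{r(r−2)} − 24 · 2^{r(r−2)/2}) + 6 · 2^{r(r−2)/2} − 1, then G contains k pairwise disjoint models of H (i.e. the disjoint union of k copies of H is a minor of G). In particular, if G does not contain k disjoint copies of H as minors then tw(G) ≤ 2^{O(r^2)} · k^2 · log(2k). -/

import Mathlib

open SimpleGraph

/-- A minor model of `H` in `G`: pairwise disjoint branch sets `B v ⊆ V(G)`, each
inducing a connected (hence nonempty) subgraph of `G`, such that for every edge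
`{u,v}` of `H` there is an edge of `G` between `B u` and `B v`. -/
def IsMinorModel {β α : Type*} (H : SimpleGraph β) (G : SimpleGraph α)
    (B : β → Set α) : Prop :=
  (∀ u, (G.induce (B u)).Connected) ∧
  (Pairwise fun u v => Disjoint (B u) (B v)) ∧
  (∀ u v, H.Adj u v → ∃ a ∈ B u, ∃ b ∈ B v, G.Adj a b)

/-- `H` is a minor of `G`. -/
def IsMinor {β α : Type*} (H : SimpleGraph β) (G : SimpleGraph α) : Prop :=
  ∃ B : β → Set α, IsMinorModel H G B

/-- `G` contains `k` models of `H` whose vertex sets are pairwise disjoint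
(equivalently, the disjoint union of `k` copies of `H` is a minor of `G`). -/
def HasDisjointModels {β α : Type*} (H : SimpleGraph β) (G : SimpleGraph α) (k : ℕ) : Prop :=
  ∃ M : Fin k → β → Set α, (∀ i, IsMinorModel H G (M i)) ∧
    Pairwise fun i j => Disjoint (⋃ u, M i u) (⋃ u, M j u)

/-- `pack_H(G)`: the maximum number of pairwise disjoint models of `H` in `G`. -/
noncomputable def packNumber {β α : Type*} (H : SimpleGraph β) (G : SimpleGraph α) : ℕ :=
  sSup {k | HasDisjointModels H G k}

/-- `S` meets every model of `H` in `G`. -/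
def IsHittingSet {β α : Type*} (H : SimpleGraph β) (G : SimpleGraph α) (S : Set α) : Prop :=
  ∀ B : β → Set α, IsMinorModel H G B → ∃ a ∈ S, ∃ u, a ∈ B u

/-- `cover_H(G)`: the minimum size of a set of vertices meeting every model of `H` in `G`. -/
noncomputable def coverNumber {β α : Type*} (H : SimpleGraph β) (G : SimpleGraph α) : ℕ :=
  sInf {n | ∃ S : Set α, IsHittingSet H G S ∧ S.ncard = n}

/-- A tree/path decomposition of `G` with underlying graph `T` and bags `X`. -/
def IsTreeDecomp {α ι : Type*} (G : SimpleGraph α) (T : SimpleGraph ι) (X : ι → Set α) : Prop :=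
  (∀ v, ∃ t, v ∈ X t) ∧
  (∀ u v, G.Adj u v → ∃ t, u ∈ X t ∧ v ∈ X t) ∧
  (∀ v, (T.induce {t | v ∈ X t}).Connected)

/-- The treewidth of `G`: the minimum width of a tree decomposition of `G`. -/
noncomputable def treewidth {α : Type*} (G : SimpleGraph α) : ℕ :=
  sInf {w | ∃ (ι : Type) (T : SimpleGraph ι) (X : ι → Set α),
    T.IsTree ∧ IsTreeDecomp G T X ∧ ∀ t, (X t).ncard ≤ w + 1}

/-- The pathwidth of `G`: the minimum width of a tree decomposition whose
underlying tree is a path. -/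
noncomputable def pathwidth {α : Type*} (G : SimpleGraph α) : ℕ :=
  sInf {w | ∃ (n : ℕ) (X : Fin (n+1) → Set α),
    IsTreeDecomp G (pathGraph (n+1)) X ∧ ∀ t, (X t).ncard ≤ w + 1}

/-- The degeneracy of `G`: the maximum over all (nonempty) subgraphs of `G`
of the minimum degree. -/
noncomputable def degeneracy {α : Type*} (G : SimpleGraph α) : ℕ :=
  sSup {d | ∃ G' : G.Subgraph, G'.verts.Nonempty ∧ ∀ v ∈ G'.verts, d ≤ (G'.neighborSet v).ncard}

/-- The contraction degeneracy of `G`: the maximum over all (nonempty) minors of `G`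
of the minimum degree. -/
noncomputable def contractionDegeneracy {α : Type*} (G : SimpleGraph α) : ℕ :=
  sSup {d | ∃ (n : ℕ) (H : SimpleGraph (Fin n)), 0 < n ∧ IsMinor H G ∧
    ∀ v, d ≤ (H.neighborSet v).ncard}


/-- `X` and `Y` are externally `q`-connected within the vertex set `W` of `G`:
for all disjoint `X' ⊆ X`, `Y' ⊆ Y` with `|X'| = |Y'| ≤ q` there are `|X'|`
pairwise disjoint `X'`–`Y'` paths (inside `W`) having no internal vertices and
no edges in `G[X ∪ Y]`. -/
def ExternallyConnectedIn {α : Type*} (G : SimpleGraph α) (W X Y : Set α) (q : ℕ) : Prop :=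
  ∀ X' Y' : Finset α, ↑X' ⊆ X → ↑Y' ⊆ Y → Disjoint (X' : Set α) (Y' : Set α) →
    X'.card = Y'.card → X'.card ≤ q →
    ∃ p : (x : X') → Σ y : Y', G.Walk x.1 y.1,
      (∀ x, (p x).2.IsPath) ∧
      (∀ x, ∀ v ∈ (p x).2.support, v ∈ W) ∧
      (Pairwise fun x₁ x₂ => ∀ v, v ∈ (p x₁).2.support → v ∉ (p x₂).2.support) ∧
      (∀ x, ∀ v ∈ (p x).2.support.tail.dropLast, v ∉ X ∪ Y) ∧
      (∀ x, ∀ u v : α, s(u, v) ∈ (p x).2.edges → ¬(u ∈ X ∪ Y ∧ v ∈ X ∪ Y))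

/-- `(A, B)` is a `q`-mesh of order `s` in `G`. -/
def IsMesh {α : Type*} (G : SimpleGraph α) (A B : Set α) (q s : ℕ) : Prop :=
  A ∪ B = Set.univ ∧
  ∃ T : G.Subgraph, T.verts ⊆ A ∧ T.coe.IsTree ∧
    (∀ v ∈ T.verts, (T.neighborSet v).ncard ≤ 3) ∧
    A ∩ B ⊆ T.verts ∧
    (∀ v ∈ A ∩ B, (T.neighborSet v).ncard ≤ 2) ∧
    (∃ v ∈ A ∩ B, (T.neighborSet v).ncard = 1) ∧
    (A ∩ B).ncard = s ∧
    ExternallyConnectedIn G B (A ∩ B) (A ∩ B) q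

/-- The graph `Ξ_r`, with vertices `x_i = (0,i)`, `y_i = (1,i)`, `z_i = (2,i)`. -/
def Xi (r : ℕ) : SimpleGraph (Fin 3 × Fin r) :=
  SimpleGraph.fromRel (fun a b =>
    (a.1 = 0 ∧ b.1 = 0 ∧ (b.2 : ℕ) = (a.2 : ℕ) + 1) ∨
    (a.1 = 2 ∧ b.1 = 2 ∧ (b.2 : ℕ) = (a.2 : ℕ) + 1) ∨
    (a.1 = 1 ∧ a.2 = b.2 ∧ (b.1 = 0 ∨ b.1 = 2)))

/-- The underlying simple bipartite graph of the bipartite multigraph with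
parts `α`, `β` and multiplicity function `m`. -/
def bipMulti {α β : Type*} (m : α → β → ℕ) : SimpleGraph (α ⊕ β) :=
  SimpleGraph.fromRel (fun x y => match x, y with
    | Sum.inl v, Sum.inr u => 1 ≤ m v u
    | _, _ => False)


/-- Every walk of `G` from `A` to `B` meets `S`. -/
def Separates {α : Type*} (G : SimpleGraph α) (A B S : Set α) : Prop :=
  ∀ a ∈ A, ∀ b ∈ B, ∀ p : G.Walk a b, ∃ v ∈ p.support, v ∈ S

/-- There are `k` pairwise disjoint paths of `G` from `A` to `B`. -/
def HasLinkage {α : Type*} (G : SimpleGraph α) (A B : Set α) (k : ℕ) : Prop :=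
  ∃ (a b : Fin k → α) (p : ∀ i, G.Walk (a i) (b i)), (∀ i, a i ∈ A) ∧ (∀ i, b i ∈ B) ∧
    (∀ i, (p i).IsPath) ∧ ∀ i j, i ≠ j → ∀ v, v ∈ (p i).support → v ∉ (p j).support

section Menger

variable {α : Type*} {G G' : SimpleGraph α} {A B S T : Set α} {k : ℕ}

lemma Separates.symm (h : Separates G A B S) : Separates G B A S := by
  intro b hb a ha p
  obtain ⟨v, hv, hvS⟩ := h a ha b hb p.reverse
  exact ⟨v, by simpa using hv, hvS⟩

lemma HasLinkage.of_walks {a b : Fin k → α} (p : ∀ i, G.Walk (a i) (b i)) (ha : ∀ i, a i ∈ A)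
    (hb : ∀ i, b i ∈ B) (hd : ∀ i j, i ≠ j → ∀ v, v ∈ (p i).support → v ∉ (p j).support) :
    HasLinkage G A B k := by
  classical
  exact ⟨a, b, fun i => (p i).bypass, ha, hb, fun i => (p i).bypass_isPath,
    fun i j hij v hv hv' => hd i j hij v ((p i).support_bypass_subset_support hv)
      ((p j).support_bypass_subset_support hv')⟩

/-- A walk of `G` either avoids the pair `x, y` or splits at it, when `G'` misses at most
the edge `xy` of `G`. -/
lemma walk_split {x y : α}
    (hG : ∀ u v, G.Adj u v → G'.Adj u v ∨ (u = x ∧ v = y) ∨ (u = y ∧ v = x))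
    {a b : α} (p : G.Walk a b) :
    (∃ q : G'.Walk a b, q.support ⊆ p.support) ∨
    (∃ (q : G'.Walk a x) (q' : G'.Walk y b), q.support ⊆ p.support ∧ q'.support ⊆ p.support) ∨
    (∃ (q : G'.Walk a y) (q' : G'.Walk x b), q.support ⊆ p.support ∧ q'.support ⊆ p.support) := by
  induction p with
  | nil => exact Or.inl ⟨Walk.nil, by simp⟩
  | @cons a c b h p ih =>
    have hsub : p.support ⊆ (Walk.cons h p).support := by simp
    rcases hG _ _ h with h' | ⟨rfl, rfl⟩ | ⟨rfl, rfl⟩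
    · rcases ih with ⟨q, hq⟩ | ⟨q, q', hq, hq'⟩ | ⟨q, q', hq, hq'⟩
      · exact Or.inl ⟨Walk.cons h' q, by simpa using List.cons_subset_cons a hq⟩
      · exact Or.inr (Or.inl ⟨Walk.cons h' q, q', by simpa using List.cons_subset_cons a hq,
          List.Subset.trans hq' hsub⟩)
      · exact Or.inr (Or.inr ⟨Walk.cons h' q, q', by simpa using List.cons_subset_cons a hq,
          List.Subset.trans hq' hsub⟩)
    · rcases ih with ⟨q, hq⟩ | ⟨q, q', hq, hq'⟩ | ⟨q, q', hq, hq'⟩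
      · exact Or.inr (Or.inl ⟨Walk.nil, q, by simp, List.Subset.trans hq hsub⟩)
      · exact Or.inr (Or.inl ⟨Walk.nil, q', by simp, List.Subset.trans hq' hsub⟩)
      · exact Or.inl ⟨q', List.Subset.trans hq' hsub⟩
    · rcases ih with ⟨q, hq⟩ | ⟨q, q', hq, hq'⟩ | ⟨q, q', hq, hq'⟩
      · exact Or.inr (Or.inr ⟨Walk.nil, q, by simp, List.Subset.trans hq hsub⟩)
      · exact Or.inl ⟨q', List.Subset.trans hq' hsub⟩
      · exact Or.inr (Or.inr ⟨Walk.nil, q', by simp, List.Subset.trans hq' hsub⟩)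

lemma walk_first_hit {x y : α}
    (hG : ∀ u v, G.Adj u v → G'.Adj u v ∨ (u = x ∧ v = y) ∨ (u = y ∧ v = x))
    (hy : y ∉ S) {a b : α} (p : G.Walk a b) (hp : ∃ v ∈ p.support, v ∈ insert x S) :
    (∃ v ∈ insert x S, ∃ q : G'.Walk a v, q.support ⊆ p.support) ∨
    (∃ q : G'.Walk a y, ∀ v ∈ q.support, v ∉ S) := by
  induction p with
  | @nil a =>
    obtain ⟨v, hv, hvS⟩ := hp
    obtain rfl : v = a := by simpa using hv
    exact Or.inl ⟨v, hvS, Walk.nil, by simp⟩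
  | @cons a c b h p ih =>
    by_cases ha : a ∈ insert x S
    · exact Or.inl ⟨a, ha, Walk.nil, by simp⟩
    have hax : a ≠ x := fun h => ha (by simp [h])
    have haS : a ∉ S := fun h => ha (by simp [h])
    have hp' : ∃ v ∈ p.support, v ∈ insert x S := by
      obtain ⟨v, hv, hvS⟩ := hp
      rcases List.mem_cons.1 (by simpa using hv) with rfl | hv
      · exact absurd hvS ha
      · exact ⟨v, hv, hvS⟩
    rcases hG _ _ h with h' | ⟨rfl, rfl⟩ | ⟨rfl, rfl⟩
    · rcases ih hp' with ⟨v, hv, q, hq⟩ | ⟨q, hq⟩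
      · exact Or.inl ⟨v, hv, Walk.cons h' q, by simpa using List.cons_subset_cons a hq⟩
      · exact Or.inr ⟨Walk.cons h' q, by simpa using ⟨haS, hq⟩⟩
    · exact absurd rfl hax
    · exact Or.inr ⟨Walk.nil, by simpa using hy⟩

lemma separates_of_separates_insert {x y : α}
    (hG : ∀ u v, G.Adj u v → G'.Adj u v ∨ (u = x ∧ v = y) ∨ (u = y ∧ v = x))
    (hS : Separates G' A B S) (hxS : Separates G A B (insert x S))
    {b : α} (hb : b ∈ B) (q : G'.Walk y b) (hq : ∀ v ∈ q.support, v ∉ S)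
    (hT : Separates G' A (insert x S) T) : Separates G A B T := by
  intro a ha b' hb' p
  rcases walk_first_hit hG (hq y (by simp)) p (hxS a ha b' hb' p) with ⟨v, hv, r, hr⟩ | ⟨r, hr⟩
  · obtain ⟨w, hw, hwT⟩ := hT a ha v hv r
    exact ⟨w, hr hw, hwT⟩
  · obtain ⟨w, hw, hwS⟩ := hS a ha b hb (r.append q)
    rcases (Walk.mem_support_append_iff _ _).1 hw with h | h
    · exact absurd hwS (hr w h)
    · exact absurd hwS (hq w h)

/-- In a linkage of full size into `S`, each path meets `S` only in its end. -/
lemma linkage_eq_end [Finite α] (hk : S.ncard ≤ k) {a b : Fin k → α}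
    {p : ∀ i, G.Walk (a i) (b i)} (hb : ∀ i, b i ∈ S)
    (hd : ∀ i j, i ≠ j → ∀ v, v ∈ (p i).support → v ∉ (p j).support) :
    (∀ s ∈ S, ∃ i, b i = s) ∧ ∀ i, ∀ v ∈ (p i).support, v ∈ S → v = b i := by
  have hinj : Function.Injective b := by
    intro i j hij
    by_contra hne
    exact hd i j hne (b i) (by simp) (by rw [hij]; simp)
  have hr : Set.range b = S := by
    apply Set.eq_of_subset_of_ncard_le (by rintro _ ⟨i, rfl⟩; exact hb i)
    rw [← Set.image_univ, Set.ncard_image_of_injective _ hinj]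
    simpa using hk
  have h1 : ∀ s ∈ S, ∃ i, b i = s := fun s hs => by rw [← hr] at hs; exact hs
  refine ⟨h1, fun i v hv hvS => ?_⟩
  obtain ⟨j, rfl⟩ := h1 v hvS
  by_contra hne
  exact hd i j (fun h => hne (by rw [h])) _ hv (by simp)

lemma linkage_glue [Finite α] {x y : α} (hle : G' ≤ G) (hxy : G.Adj x y) (hx : x ∉ S) (hy : y ∉ S)
    (hk : S.ncard + 1 = k) (hS : Separates G' A B S) (hP : HasLinkage G' A (insert x S) k)
    (hQ : HasLinkage G' (insert y S) B k) : HasLinkage G A B k := by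
  classical
  obtain ⟨a, b, p, ha, hb, hp, hpd⟩ := hP
  obtain ⟨c, d, q, hc, hd, hq, hqd⟩ := hQ
  have hcx : (insert x S).ncard ≤ k := by rw [Set.ncard_insert_of_notMem hx]; omega
  have hcy : (insert y S).ncard ≤ k := by rw [Set.ncard_insert_of_notMem hy]; omega
  obtain ⟨-, hp1⟩ := linkage_eq_end hcx hb hpd
  obtain ⟨hq0, hq1⟩ := linkage_eq_end (p := fun i => (q i).reverse) hcy hc
    (fun i j hij v => by simpa using hqd i j hij v)
  simp only [Walk.support_reverse, List.mem_reverse] at hq1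
  have hcross : ∀ i j v, v ∈ (p i).support → v ∈ (q j).support → v ∈ S ∧ v = b i ∧ v = c j := by
    intro i j v hv hv'
    have hvS : v ∈ S := by
      obtain ⟨w, hw, hwS⟩ := hS _ (ha i) _ (hd j) (((p i).takeUntil v hv).append
        ((q j).dropUntil v hv'))
      rcases (Walk.mem_support_append_iff _ _).1 hw with h | h
      · have hwb := hp1 i w ((p i).support_takeUntil_subset_support hv h) (by simp [hwS])
        by_contra hvS
        have : b i ≠ v := by rintro rfl; exact hvS (hwb ▸ hwS)
        exact Walk.endpoint_notMem_support_takeUntil (hp i) hv this (hwb ▸ h)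
      · have hwc := hq1 j w ((q j).support_dropUntil_subset_support hv' h) (by simp [hwS])
        by_contra hvS
        have hne : c j ≠ v := by rintro rfl; exact hvS (hwc ▸ hwS)
        have hnd := (hq j).support_nodup
        rw [← (q j).take_spec hv', Walk.support_append] at hnd
        rw [hwc] at h
        have h2 : c j ∈ ((q j).dropUntil v hv').support.tail := by
          rcases (Walk.mem_support_iff _).1 h with h | h
          · exact absurd h hne
          · exact h
        exact (List.nodup_append.1 hnd).2.2 (c j) (by simp) (c j) h2 rfl
    exact ⟨hvS, hp1 i v hv (by simp [hvS]), hq1 j v hv' (by simp [hvS])⟩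
  have hτ : ∀ i, ∃ j, (b i ∈ S ∧ c j = b i) ∨ (b i = x ∧ c j = y) := by
    intro i
    rcases hb i with h | h
    · obtain ⟨j, hj⟩ := hq0 y (by simp)
      exact ⟨j, Or.inr ⟨h, hj⟩⟩
    · obtain ⟨j, hj⟩ := hq0 (b i) (by simp [h])
      exact ⟨j, Or.inl ⟨h, hj⟩⟩
  choose τ hτ using hτ
  have hbinj : ∀ i j, b i = b j → i = j := by
    intro i j hij
    by_contra hne
    exact hpd i j hne (b i) (by simp) (by rw [hij]; simp)
  have hτinj : ∀ i j, τ i = τ j → i = j := by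
    intro i j hij
    apply hbinj
    have h1 := hτ i
    rw [hij] at h1
    rcases h1 with ⟨h1, h2⟩ | ⟨h1, h2⟩ <;> rcases hτ j with ⟨h3, h4⟩ | ⟨h3, h4⟩
    · rw [← h2, h4]
    · rw [h4] at h2; exact absurd (h2 ▸ h1) hy
    · rw [h2] at h4; exact absurd (h4 ▸ h3) hy
    · rw [h1, h3]
  have hr : ∀ i, ∃ r : G.Walk (a i) (d (τ i)), ∀ v ∈ r.support,
      v ∈ (p i).support ∨ v ∈ (q (τ i)).support := by
    intro i
    rcases hτ i with ⟨-, h⟩ | ⟨h, h'⟩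
    · refine ⟨((p i).mapLe hle).append (((q (τ i)).mapLe hle).copy h rfl), fun v hv => ?_⟩
      simpa [Walk.mem_support_append_iff] using hv
    · refine ⟨((p i).mapLe hle).append
        (Walk.cons (show G.Adj (b i) (c (τ i)) by rw [h, h']; exact hxy) ((q (τ i)).mapLe hle)),
        fun v hv => ?_⟩
      rcases (Walk.mem_support_append_iff _ _).1 hv with h | h
      · left; simpa using h
      · rcases List.mem_cons.1 (by simpa using h) with rfl | h
        · left; simp
        · right; exact h
  choose r hr using hr
  refine HasLinkage.of_walks r ha (fun i => hd _) fun i j hij v hv hv' => ?_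
  have key : ∀ i j, i ≠ j → v ∈ (p i).support → v ∉ (q (τ j)).support := by
    intro i j hij h h'
    obtain ⟨h1, h2, h3⟩ := hcross _ _ _ h h'
    rcases hτ j with ⟨-, h4⟩ | ⟨-, h4⟩
    · exact hij (hbinj _ _ (by rw [← h2, h3, h4]))
    · rw [h4] at h3; exact hy (h3 ▸ h1)
  rcases hr i v hv with h | h <;> rcases hr j v hv' with h' | h'
  · exact hpd i j hij v h h'
  · exact key i j hij h h'
  · exact key j i hij.symm h' h
  · exact hqd _ _ (fun h => hij (hτinj _ _ h)) v h h'

/-- **Menger's theorem** for sets of vertices of a finite graph. -/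
theorem hasLinkage_of_le_separator [Finite α] (G : SimpleGraph α) (A B : Set α) (k : ℕ)
    (h : ∀ S, Separates G A B S → k ≤ S.ncard) : HasLinkage G A B k := by
  induction hn : G.edgeSet.ncard using Nat.strong_induction_on generalizing G A B with
  | _ n ih =>
  subst hn
  by_cases hE : ∃ x y, G.Adj x y
  swap
  · push Not at hE
    have hs : Separates G A B (A ∩ B) := by
      intro a ha b hb p
      cases p with
      | nil => exact ⟨a, by simp, ha, hb⟩
      | cons h _ => exact absurd h (hE _ _)
    have hk := h _ hs
    have : Fintype ↥(A ∩ B) := Fintype.ofFinite _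
    rw [← Nat.card_coe_set_eq, Nat.card_eq_fintype_card] at hk
    obtain ⟨f⟩ : Nonempty (Fin k ↪ ↥(A ∩ B)) :=
      Function.Embedding.nonempty_of_card_le (by simpa using hk)
    refine HasLinkage.of_walks (a := fun i => (f i : α)) (fun i => Walk.nil)
      (fun i => (f i).2.1) (fun i => (f i).2.2) fun i j hij v hv hv' => ?_
    simp only [Walk.support_nil, List.mem_singleton] at hv hv'
    exact hij (f.injective (Subtype.ext (hv.symm.trans hv')))
  obtain ⟨x, y, hxy⟩ := hE
  set G' := G.deleteEdges {s(x, y)} with hG'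
  have hle : G' ≤ G := G.deleteEdges_le _
  have hlt : G'.edgeSet.ncard < G.edgeSet.ncard := by
    apply Set.ncard_lt_ncard _ (Set.toFinite _)
    rw [hG', edgeSet_deleteEdges]
    exact Set.sdiff_singleton_ssubset.2 hxy
  by_cases h' : ∀ S, Separates G' A B S → k ≤ S.ncard
  · obtain ⟨a, b, p, ha, hb, -, hd⟩ := ih _ hlt G' A B h' rfl
    exact HasLinkage.of_walks (fun i => (p i).mapLe hle) ha hb (by simpa using hd)
  push Not at h'
  obtain ⟨S, hS, hSk⟩ := h'
  have hnot : ¬ Separates G A B S := fun hs => absurd (h S hs) (by omega)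
  unfold Separates at hnot
  push Not at hnot
  obtain ⟨a, ha, b, hb, p, hp⟩ := hnot
  have main : ∀ x y, G.Adj x y →
      (∀ u v, G.Adj u v → G'.Adj u v ∨ (u = x ∧ v = y) ∨ (u = y ∧ v = x)) →
      ∀ (q : G'.Walk a x) (q' : G'.Walk y b), q.support ⊆ p.support → q'.support ⊆ p.support →
      HasLinkage G A B k := by
    intro x y hxy hG q q' hq hq'
    have hq : ∀ v ∈ q.support, v ∉ S := fun v hv => hp v (hq hv)
    have hq' : ∀ v ∈ q'.support, v ∉ S := fun v hv => hp v (hq' hv)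
    have hx := hq x (by simp)
    have hy := hq' y (by simp)
    have hxS : Separates G A B (insert x S) := by
      intro a ha b hb p
      rcases walk_split hG p with ⟨r, hr⟩ | ⟨r, r', hr, hr'⟩ | ⟨r, r', hr, hr'⟩
      · obtain ⟨v, hv, hvS⟩ := hS a ha b hb r
        exact ⟨v, hr hv, by simp [hvS]⟩
      · exact ⟨x, hr (by simp), by simp⟩
      · exact ⟨x, hr' (by simp), by simp⟩
    have hyS : Separates G A B (insert y S) := by
      intro a ha b hb p
      rcases walk_split hG p with ⟨r, hr⟩ | ⟨r, r', hr, hr'⟩ | ⟨r, r', hr, hr'⟩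
      · obtain ⟨v, hv, hvS⟩ := hS a ha b hb r
        exact ⟨v, hr hv, by simp [hvS]⟩
      · exact ⟨y, hr' (by simp), by simp⟩
      · exact ⟨y, hr (by simp), by simp⟩
    have hkS := h _ hxS
    rw [Set.ncard_insert_of_notMem hx] at hkS
    refine linkage_glue hle hxy hx hy (by omega) hS (ih _ hlt G' _ _ (fun T hT => h T ?_) rfl)
      (ih _ hlt G' _ _ (fun T hT => h T ?_) rfl)
    · exact separates_of_separates_insert hG hS hxS hb q' hq' hT
    · exact (separates_of_separates_insert (fun u v huv => (hG u v huv).imp_right Or.symm)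
        hS.symm hyS.symm ha q.reverse (by simpa using hq) hT.symm).symm
  have hG : ∀ u v, G.Adj u v → G'.Adj u v ∨ (u = x ∧ v = y) ∨ (u = y ∧ v = x) := by
    intro u v huv
    by_cases he : s(u, v) = s(x, y)
    · right; simpa using he
    · left; rw [hG', deleteEdges_adj]; exact ⟨huv, he⟩
  rcases walk_split hG p with ⟨q, hq⟩ | ⟨q, q', hq, hq'⟩ | ⟨q, q', hq, hq'⟩
  · obtain ⟨v, hv, hvS⟩ := hS a ha b hb q
    exact absurd hvS (hp v (hq hv))
  · exact main x y hxy hG q q' hq hq'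
  · exact main y x hxy.symm (fun u v huv => (hG u v huv).imp_right Or.symm) q q' hq hq'

end Menger

section Connectivity

variable {α : Type*} {G : SimpleGraph α} {S T C D : Set α}

lemma forall_mem_of_induce_connected (hS : (G.induce S).Connected) {P : α → Prop} {a : α}
    (ha : a ∈ S) (hPa : P a) (hstep : ∀ u ∈ S, ∀ v ∈ S, P u → G.Adj u v → P v) :
    ∀ v ∈ S, P v := by
  intro v hv
  obtain ⟨p⟩ := hS.preconnected ⟨a, ha⟩ ⟨v, hv⟩
  have : ∀ (x y : S), (G.induce S).Walk x y → P x → P y := by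
    intro x y p
    induction p with
    | nil => exact id
    | cons h _ ih => exact fun hx => ih (hstep _ (Subtype.prop _) _ (Subtype.prop _) hx h)
  exact this _ _ p hPa

lemma induce_connected_of_forall {a : α} (ha : a ∈ S)
    (h : ∀ P : α → Prop, P a → (∀ u ∈ S, ∀ v ∈ S, P u → G.Adj u v → P v) → ∀ v ∈ S, P v) :
    (G.induce S).Connected := by
  rw [connected_iff_exists_forall_reachable]
  refine ⟨⟨a, ha⟩, fun ⟨v, hv⟩ => ?_⟩
  obtain ⟨_, h'⟩ := h (fun v => ∃ hv : v ∈ S, (G.induce S).Reachable ⟨a, ha⟩ ⟨v, hv⟩)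
    ⟨ha, Reachable.refl _⟩ (fun u _ v hv ⟨hu, hr⟩ huv => ⟨hv, hr.trans
      (Adj.reachable (show (G.induce S).Adj ⟨u, hu⟩ ⟨v, hv⟩ from huv))⟩) v hv
  exact h'

lemma induce_connected_nonempty (hS : (G.induce S).Connected) : S.Nonempty :=
  let ⟨⟨a, ha⟩⟩ := hS.nonempty
  ⟨a, ha⟩

/-- The vertices outside `C` with a neighbour in `C`. -/
def outerNbhd (G : SimpleGraph α) (C : Set α) : Set α :=
  {v | v ∉ C ∧ ∃ u ∈ C, G.Adj u v}

lemma subset_of_disjoint_outerNbhd (hD : (G.induce D).Connected) (hDC : (D ∩ C).Nonempty)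
    (h : Disjoint D (outerNbhd G C)) : D ⊆ C := by
  obtain ⟨a, haD, haC⟩ := hDC
  refine forall_mem_of_induce_connected hD haD haC fun u hu v hv huC huv => ?_
  by_contra hvC
  exact Set.disjoint_left.1 h hv ⟨hvC, u, huC, huv⟩

/-- Every vertex outside `T` lies in a component of `G - T`. -/
lemma exists_component (G : SimpleGraph α) {a : α} (ha : a ∉ T) :
    ∃ D, a ∈ D ∧ (G.induce D).Connected ∧ Disjoint D T ∧ outerNbhd G D ⊆ T := by
  refine ⟨{v | ∃ p : G.Walk a v, ∀ w ∈ p.support, w ∉ T}, ⟨Walk.nil, by simpa using ha⟩, ?_,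
    ?_, ?_⟩
  · refine induce_connected_of_forall (a := a) ⟨Walk.nil, by simpa using ha⟩ ?_
    rintro P hPa hstep v ⟨p, hp⟩
    have : ∀ x y, ∀ p : G.Walk x y, (∃ q : G.Walk a x, ∀ w ∈ q.support, w ∉ T) →
        (∀ w ∈ p.support, w ∉ T) → P x → P y := by
      intro x y p
      induction p with
      | nil => exact fun _ _ h => h
      | @cons x z y h p ih =>
        rintro ⟨q, hq⟩ hp hx
        have hz : ∃ q : G.Walk a z, ∀ w ∈ q.support, w ∉ T := by
          refine ⟨q.concat h, fun w hw => ?_⟩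
          rw [Walk.support_concat] at hw
          rcases (by simpa using hw : w ∈ q.support ∨ w = z) with h' | rfl
          · exact hq w h'
          · exact hp w (by simp)
        exact ih hz (fun w hw => hp w (by simp [hw])) (hstep x ⟨q, hq⟩ z hz hx h)
    exact this _ _ p ⟨Walk.nil, by simpa using ha⟩ hp hPa
  · rw [Set.disjoint_left]
    rintro v ⟨p, hp⟩
    exact hp v (by simp)
  · rintro v ⟨hv, u, ⟨p, hp⟩, huv⟩
    by_contra hvT
    refine hv ⟨p.concat huv, fun w hw => ?_⟩
    rw [Walk.support_concat] at hw
    rcases (by simpa using hw : w ∈ p.support ∨ w = v) with h' | rfl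
    · exact hp w h'
    · exact hvT

lemma exists_component_superset (hC : (G.induce C).Connected) (h : Disjoint C T) :
    ∃ D, C ⊆ D ∧ (G.induce D).Connected ∧ Disjoint D T ∧ outerNbhd G D ⊆ T := by
  obtain ⟨a, ha⟩ := induce_connected_nonempty hC
  obtain ⟨D, haD, hD, hDT, hDN⟩ := exists_component G (Set.disjoint_left.1 h ha)
  exact ⟨D, subset_of_disjoint_outerNbhd hC ⟨a, ha, haD⟩ (h.mono_right hDN), hD, hDT, hDN⟩

lemma outerNbhd_subset_union (h : C ⊆ D) : outerNbhd G C ⊆ D ∪ outerNbhd G D := by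
  rintro v ⟨-, u, hu, huv⟩
  by_cases hv : v ∈ D
  · exact Or.inl hv
  · exact Or.inr ⟨hv, u, h hu, huv⟩

end Connectivity

section TreeDecomposition

/-- The graph on `Fin (n + 1)` joining each nonzero node to its parent. -/
def parentGraph (n : ℕ) (par : ℕ → ℕ) : SimpleGraph (Fin (n + 1)) :=
  SimpleGraph.fromRel fun i j => 0 < (j : ℕ) ∧ par j = i

lemma parentGraph_adj {n : ℕ} {par : ℕ → ℕ} (h : ∀ i, 0 < i → i ≤ n → par i < i)
    {i j : Fin (n + 1)} (hj : 0 < (j : ℕ)) (hij : par j = i) : (parentGraph n par).Adj i j := by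
  refine (SimpleGraph.fromRel_adj _ _ _).2 ⟨?_, Or.inl ⟨hj, hij⟩⟩
  rintro rfl
  exact absurd (h i hj (by omega)) (by omega)

lemma parentGraph_isTree {n : ℕ} {par : ℕ → ℕ} (h : ∀ i, 0 < i → i ≤ n → par i < i) :
    (parentGraph n par).IsTree := by
  have hconn : (parentGraph n par).Connected := by
    rw [connected_iff_exists_forall_reachable]
    refine ⟨0, fun ⟨i, hi⟩ => ?_⟩
    induction i using Nat.strong_induction_on with
    | _ i ih =>
      rcases Nat.eq_zero_or_pos i with rfl | hpos
      · exact Reachable.refl _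
      · have hp := h i hpos (by omega)
        exact (ih _ hp (by omega)).trans (parentGraph_adj h hpos rfl).reachable
  rw [isTree_iff_connected_and_card]
  refine ⟨hconn, le_antisymm ?_ hconn.card_vert_le_card_edgeSet_add_one⟩
  have hsurj : (parentGraph n par).edgeSet ⊆
      (fun j : Fin n => s(Fin.ofNat (n + 1) (par (j + 1)), j.succ)) '' Set.univ := by
    intro e
    induction e with
    | _ x y =>
      have key : ∀ x y : Fin (n + 1), 0 < (y : ℕ) → par y = x →
          s(x, y) ∈ (fun j : Fin n => s(Fin.ofNat (n + 1) (par (j + 1)), j.succ)) '' Set.univ := by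
        intro x y hy hxy
        refine ⟨⟨y - 1, by omega⟩, trivial, ?_⟩
        have h1 : (y : ℕ) - 1 + 1 = y := by omega
        have h2 : Fin.ofNat (n + 1) (x : ℕ) = x := by simp
        have h3 : (⟨(y : ℕ) - 1, by omega⟩ : Fin n).succ = y := Fin.ext h1
        simp only [h1, hxy, h2, h3]
      intro hxy
      rcases ((SimpleGraph.fromRel_adj _ _ _).1
        (show (parentGraph n par).Adj x y from hxy)).2 with ⟨h1, h2⟩ | ⟨h1, h2⟩
      · exact key x y h1 h2
      · rw [Sym2.eq_swap]; exact key y x h1 h2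
  have h1 := Set.ncard_le_ncard hsurj (Set.toFinite _)
  have h2 := Set.ncard_image_le (f := fun j : Fin n => s(Fin.ofNat (n + 1) (par (j + 1)), j.succ))
    (s := Set.univ) (Set.toFinite _)
  rw [Set.ncard_univ, Nat.card_fin] at h2
  rw [Nat.card_coe_set_eq, Nat.card_fin]
  omega

/-- A rooted tree decomposition with nodes `0, …, n` and bags of size at most `4 * q` of an induced
subgraph of `G`, such that every component of the rest attaches to at most `3 * q` vertices
of a single bag. -/
structure IsPartialDecomp {α : Type*} (G : SimpleGraph α) (q n : ℕ) (par : ℕ → ℕ)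
    (X : ℕ → Set α) : Prop where
  par_lt : ∀ i, 0 < i → i ≤ n → par i < i
  card_le : ∀ i ≤ n, (X i).ncard ≤ 4 * q
  edge : ∀ i ≤ n, ∀ j ≤ n, ∀ u ∈ X i, ∀ v ∈ X j, G.Adj u v → ∃ k ≤ n, u ∈ X k ∧ v ∈ X k
  root_unique : ∀ i ≤ n, ∀ j ≤ n, ∀ v, v ∈ X i → v ∈ X j → (i = 0 ∨ v ∉ X (par i)) →
    (j = 0 ∨ v ∉ X (par j)) → i = j
  comp : ∀ K, (G.induce K).Connected → Disjoint K (⋃ i ≤ n, X i) →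
    outerNbhd G K ⊆ (⋃ i ≤ n, X i) → (∃ i ≤ n, outerNbhd G K ⊆ X i) ∧ (outerNbhd G K).ncard ≤ 3 * q

variable {α : Type*} {G : SimpleGraph α} {q n : ℕ} {par : ℕ → ℕ} {X : ℕ → Set α}

lemma IsPartialDecomp.extend (hX : IsPartialDecomp G q n par X) {K S : Set α} {t : ℕ} (ht : t ≤ n)
    (hKX : Disjoint K (⋃ i ≤ n, X i)) (hKN : outerNbhd G K ⊆ X t)
    (hSK : S ⊆ K) (hcard : (outerNbhd G K ∪ S).ncard ≤ 4 * q)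
    (hcomp : ∀ K', (G.induce K').Connected → K' ⊆ K → Disjoint K' S →
      outerNbhd G K' ⊆ outerNbhd G K ∪ S → (outerNbhd G K').ncard ≤ 3 * q) :
    ∃ par' X', IsPartialDecomp G q (n + 1) par' X' ∧
      (⋃ i ≤ n + 1, X' i) = (⋃ i ≤ n, X i) ∪ S := by
  classical
  set U := ⋃ i ≤ n, X i with hU
  set N := outerNbhd G K with hN
  have hXU : ∀ i ≤ n, X i ⊆ U := fun i hi v hv => by
    simp only [hU, Set.mem_iUnion]; exact ⟨i, hi, hv⟩
  have hU' : ∀ v ∈ U, ∃ i ≤ n, v ∈ X i := fun v hv => by simpa [hU] using hv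
  have hKU : ∀ v ∈ K, v ∉ U := fun v hv => Set.disjoint_left.1 hKX hv
  set X' := Function.update X (n + 1) (N ∪ S) with hX'
  set par' := Function.update par (n + 1) t with hpar'
  have hXold : ∀ i ≤ n, X' i = X i := fun i hi => Function.update_of_ne (by omega) _ _
  have hXnew : X' (n + 1) = N ∪ S := Function.update_self _ _ _
  have hpold : ∀ i ≤ n, par' i = par i := fun i hi => Function.update_of_ne (by omega) _ _
  have hpnew : par' (n + 1) = t := Function.update_self _ _ _
  have hle : ∀ i, i ≤ n + 1 → i ≤ n ∨ i = n + 1 := fun i hi => by omega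
  have hunion : (⋃ i ≤ n + 1, X' i) = U ∪ S := by
    ext v
    simp only [Set.mem_iUnion, Set.mem_union]
    constructor
    · rintro ⟨i, hi, hv⟩
      rcases hle i hi with hi | rfl
      · rw [hXold i hi] at hv; exact Or.inl (hXU i hi hv)
      · rw [hXnew] at hv
        exact hv.imp_left fun h => hXU t ht (hKN h)
    · rintro (hv | hv)
      · obtain ⟨i, hi, hv⟩ := hU' v hv
        exact ⟨i, by omega, by rwa [hXold i hi]⟩
      · exact ⟨n + 1, le_rfl, by rw [hXnew]; exact Or.inr hv⟩
  have hmem : ∀ i ≤ n + 1, ∀ v ∈ X' i, v ∈ U ∨ v ∈ S := fun i hi v hv => by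
    have : v ∈ ⋃ i ≤ n + 1, X' i := by simp only [Set.mem_iUnion]; exact ⟨i, hi, hv⟩
    rwa [hunion] at this
  refine ⟨par', X', ⟨?_, ?_, ?_, ?_, ?_⟩, hunion⟩
  · intro i hi hin
    rcases hle i hin with h | rfl
    · rw [hpold i h]; exact hX.par_lt i hi h
    · rw [hpnew]; omega
  · intro i hi
    rcases hle i hi with h | rfl
    · rw [hXold i h]; exact hX.card_le i h
    · rwa [hXnew]
  · have key : ∀ u ∈ S, ∀ v, v ∈ U ∨ v ∈ S → G.Adj u v → v ∈ N ∪ S := by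
      rintro u hu v (hv | hv) huv
      · exact Or.inl ⟨fun h => hKU v h hv, u, hSK hu, huv⟩
      · exact Or.inr hv
    intro i hi j hj u hu v hv huv
    rcases hmem i hi u hu with hu | hu
    · rcases hmem j hj v hv with hv | hv
      · obtain ⟨i', hi', hu'⟩ := hU' u hu
        obtain ⟨j', hj', hv'⟩ := hU' v hv
        obtain ⟨k, hk, h1, h2⟩ := hX.edge i' hi' j' hj' u hu' v hv' huv
        exact ⟨k, by omega, by rwa [hXold k hk], by rwa [hXold k hk]⟩
      · exact ⟨n + 1, le_rfl, by rw [hXnew]; exact key v hv u (Or.inl hu) huv.symm,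
          by rw [hXnew]; exact Or.inr hv⟩
    · exact ⟨n + 1, le_rfl, by rw [hXnew]; exact Or.inr hu,
          by rw [hXnew]; exact key u hu v (hmem j hj v hv) huv⟩
  · have key : ∀ v, v ∈ X' (n + 1) → (n + 1 = 0 ∨ v ∉ X' (par' (n + 1))) → v ∉ U := by
      intro v hv h
      rw [hpnew, hXold t ht, hXnew] at *
      rcases hv with hv | hv
      · exact absurd (hKN hv) (h.resolve_left (by omega))
      · exact hKU v (hSK hv)
    have hpar : ∀ i ≤ n, ∀ v, (i = 0 ∨ v ∉ X' (par' i)) → (i = 0 ∨ v ∉ X (par i)) := by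
      intro i hi v h
      rcases Nat.eq_zero_or_pos i with h0 | h0
      · exact Or.inl h0
      · rw [hpold i hi, hXold _ (by have := hX.par_lt i h0 hi; omega)] at h; exact h
    intro i hi j hj v hvi hvj h1 h2
    rcases hle i hi with h | rfl <;> rcases hle j hj with h' | rfl
    · rw [hXold _ h] at hvi
      rw [hXold _ h'] at hvj
      exact hX.root_unique i h j h' v hvi hvj (hpar i h v h1) (hpar j h' v h2)
    · rw [hXold _ h] at hvi
      exact absurd (hXU i h hvi) (key v hvj h2)
    · rw [hXold _ h'] at hvj
      exact absurd (hXU j h' hvj) (key v hvi h1)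
    · rfl
  · rw [hunion]
    intro K' hK' hdisj hsub
    rw [Set.disjoint_union_right] at hdisj
    by_cases hne : (K' ∩ K).Nonempty
    · have hsubK : K' ⊆ K := subset_of_disjoint_outerNbhd hK' hne
        (hdisj.1.mono_right (hKN.trans (hXU t ht)))
      have hN' : outerNbhd G K' ⊆ N ∪ S := by
        intro v hv
        rcases outerNbhd_subset_union hsubK hv with h | h
        · exact Or.inr ((hsub hv).resolve_left (hKU v h))
        · exact Or.inl h
      exact ⟨⟨n + 1, le_rfl, by rwa [hXnew]⟩, hcomp K' hK' hsubK hdisj.2 hN'⟩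
    · have hN' : outerNbhd G K' ⊆ U := by
        rintro v hv
        refine (hsub hv).resolve_right fun hvS => ?_
        obtain ⟨-, u, hu, huv⟩ := hv
        have huK : u ∉ K := fun h => hne ⟨u, hu, h⟩
        exact Set.disjoint_left.1 hdisj.1 hu
          (hXU t ht (hKN ⟨huK, v, hSK hvS, huv.symm⟩))
      obtain ⟨⟨i, hi, h1⟩, h2⟩ := hX.comp K' hK' hdisj.1 hN'
      exact ⟨⟨i, by omega, by rwa [hXold i hi]⟩, h2⟩

lemma IsPartialDecomp.treewidth_le (hX : IsPartialDecomp G q n par X) (hq : 0 < q)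
    (hU : (⋃ i ≤ n, X i) = Set.univ) : treewidth G < 4 * q := by
  have hU' : ∀ v, ∃ i ≤ n, v ∈ X i := fun v => by simpa [← hU] using Set.mem_univ v
  have : 4 * q - 1 ∈ {w | ∃ (ι : Type) (T : SimpleGraph ι) (X : ι → Set α),
      T.IsTree ∧ IsTreeDecomp G T X ∧ ∀ t, (X t).ncard ≤ w + 1} := by
    refine ⟨Fin (n + 1), parentGraph n par, fun i => X i, parentGraph_isTree hX.par_lt,
      ⟨?_, ?_, ?_⟩, fun i => (hX.card_le i (by omega)).trans (by omega)⟩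
    · intro v
      obtain ⟨i, hi, hv⟩ := hU' v
      exact ⟨⟨i, by omega⟩, hv⟩
    · intro u v huv
      obtain ⟨i, hi, hu⟩ := hU' u
      obtain ⟨j, hj, hv⟩ := hU' v
      obtain ⟨k, hk, h1, h2⟩ := hX.edge i hi j hj u hu v hv huv
      exact ⟨⟨k, by omega⟩, h1, h2⟩
    · intro v
      classical
      have hex : ∃ i, i ≤ n ∧ v ∈ X i := hU' v
      have h0 := Nat.find_spec hex
      have hroot : ∀ i, i ≤ n → v ∈ X i → (i = 0 ∨ v ∉ X (par i)) → i = Nat.find hex := by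
        intro i hi hv h
        refine hX.root_unique i hi _ h0.1 v hv h0.2 h ?_
        rcases Nat.eq_zero_or_pos (Nat.find hex) with h' | h'
        · exact Or.inl h'
        · have hlt := hX.par_lt _ h' h0.1
          exact Or.inr fun hv' => Nat.find_min hex hlt ⟨by omega, hv'⟩
      refine induce_connected_of_forall (a := ⟨Nat.find hex, by omega⟩) h0.2 ?_
      rintro P hP hstep ⟨i, hi⟩ hv
      induction i using Nat.strong_induction_on with
      | _ i ih =>
        by_cases h : i = 0 ∨ v ∉ X (par i)
        · have := hroot i (by omega) hv h
          subst this
          exact hP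
        · push Not at h
          have hlt := hX.par_lt i (by omega) (by omega)
          exact hstep ⟨par i, by omega⟩ h.2 ⟨i, hi⟩ hv (ih _ hlt (by omega) h.2)
            (parentGraph_adj hX.par_lt (show 0 < i by omega) rfl)
  have := Nat.sInf_le this
  unfold treewidth
  omega

/-- A connected vertex set containing more than half of `W`. -/
def IsBig (G : SimpleGraph α) (W D : Set α) : Prop :=
  (G.induce D).Connected ∧ W.ncard < 2 * (W ∩ D).ncard

/-- In a graph of large treewidth some set `W` points to a unique big component after deleting
any few vertices. -/
theorem exists_big_component_of_le_treewidth [Finite α] (hq : 0 < q) (h : 4 * q ≤ treewidth G) :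
    ∃ W : Set α, ∀ T : Set α, T.ncard ≤ q →
      ∃ D, IsBig G W D ∧ Disjoint D T ∧ outerNbhd G D ⊆ T := by
  by_contra! hcon
  have hsep : ∀ W : Set α, ∃ T : Set α, T.ncard ≤ q ∧ ∀ D, (G.induce D).Connected → Disjoint D T →
      outerNbhd G D ⊆ T → 2 * (W ∩ D).ncard ≤ W.ncard := by
    intro W
    obtain ⟨T, hT, hD⟩ := hcon W
    refine ⟨T, hT, fun D h1 h2 h3 => ?_⟩
    by_contra! hlt
    exact hD D ⟨h1, hlt⟩ h2 h3
  have main : ∀ m n par X, IsPartialDecomp G q n par X → (⋃ i ≤ n, X i)ᶜ.ncard = m → False := by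
    intro m
    induction m using Nat.strong_induction_on with
    | _ m ih =>
    intro n par X hX hm
    by_cases hU : (⋃ i ≤ n, X i) = Set.univ
    · exact absurd (hX.treewidth_le hq hU) (by omega)
    obtain ⟨a, ha⟩ := (Set.ne_univ_iff_exists_notMem _).1 hU
    obtain ⟨K, haK, hK, hKU, hKN⟩ := exists_component G ha
    obtain ⟨⟨t, ht, hNt⟩, hN3⟩ := hX.comp K hK hKU hKN
    have step : ∀ S ⊆ K, S.Nonempty → (outerNbhd G K ∪ S).ncard ≤ 4 * q →
        (∀ K', (G.induce K').Connected → K' ⊆ K → Disjoint K' S →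
          outerNbhd G K' ⊆ outerNbhd G K ∪ S → (outerNbhd G K').ncard ≤ 3 * q) → False := by
      intro S hSK ⟨s, hs⟩ hcard hcomp
      obtain ⟨par', X', hX', hU'⟩ := hX.extend ht hKU hNt hSK hcard hcomp
      refine ih _ ?_ (n + 1) par' X' hX' rfl
      rw [← hm, hU']
      refine Set.ncard_lt_ncard ?_ (Set.toFinite _)
      refine compl_lt_compl_iff_lt.2 ?_
      refine Set.ssubset_iff_of_subset Set.subset_union_left |>.2 ⟨s, Or.inr hs, ?_⟩
      exact Set.disjoint_left.1 hKU (hSK hs)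
    by_cases hsmall : (outerNbhd G K).ncard ≤ 2 * q
    · have h1 : (outerNbhd G K ∪ {a}).ncard ≤ 2 * q + 1 := by
        have := Set.ncard_union_le (outerNbhd G K) {a}
        rw [Set.ncard_singleton] at this
        omega
      refine step {a} (by simpa using haK) (by simp) (by omega) fun K' _ _ _ hsub => ?_
      have := Set.ncard_le_ncard hsub (Set.toFinite _)
      omega
    obtain ⟨T, hTq, hT⟩ := hsep (outerNbhd G K)
    have hhalf : ∀ K', (G.induce K').Connected → Disjoint K' T →
        outerNbhd G K' \ T ⊆ outerNbhd G K →
        2 * (outerNbhd G K').ncard ≤ 2 * q + (outerNbhd G K).ncard := by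
      intro K' hK' hK'T hsub
      obtain ⟨D, hKD, hD, hDT, hDN⟩ := exists_component_superset hK' hK'T
      have h1 := hT D hD hDT hDN
      have h2 : outerNbhd G K' \ T ⊆ outerNbhd G K ∩ D := by
        intro v hv
        refine ⟨hsub hv, ?_⟩
        rcases outerNbhd_subset_union hKD hv.1 with h | h
        · exact h
        · exact absurd (hDN h) hv.2
      have h3 := Set.ncard_le_ncard h2 (Set.toFinite _)
      have h4 : (outerNbhd G K').ncard ≤ (outerNbhd G K' \ T).ncard + T.ncard := by
        refine (Set.ncard_le_ncard (t := (outerNbhd G K' \ T) ∪ T) ?_ (Set.toFinite _)).trans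
          (Set.ncard_union_le _ _)
        intro v hv
        by_cases hvT : v ∈ T
        · exact Or.inr hvT
        · exact Or.inl ⟨hv, hvT⟩
      omega
    refine step (T ∩ K) Set.inter_subset_right ?_ ?_ ?_
    · by_contra hne
      have hKT : Disjoint K T := by
        rw [Set.disjoint_left]
        exact fun v hv hvT => hne ⟨v, hvT, hv⟩
      have := hhalf K hK hKT fun v hv => hv.1
      omega
    · have h1 := Set.ncard_union_le (outerNbhd G K) (T ∩ K)
      have h2 := Set.ncard_le_ncard (Set.inter_subset_left (s := T) (t := K)) (Set.toFinite _)
      omega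
    · intro K' hK' hsub hdisj hN'
      have hK'T : Disjoint K' T := by
        rw [Set.disjoint_left] at hdisj ⊢
        exact fun v hv hvT => hdisj hv ⟨hvT, hsub hv⟩
      have := hhalf K' hK' hK'T fun v hv => (hN' hv.1).resolve_right fun h => hv.2 h.1
      omega
  refine main _ 0 id (fun _ => ∅) ⟨?_, ?_, ?_, ?_, ?_⟩ rfl
  · intro i h1 h2; omega
  · simp
  · simp
  · simp
  · intro K _ _ h
    have h0 : outerNbhd G K = ∅ := by
      rw [Set.eq_empty_iff_forall_notMem]
      intro v hv
      simpa using h hv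
    exact ⟨⟨0, le_rfl, by simp [h0]⟩, by simp [h0]⟩

end TreeDecomposition

section PathModel

variable {α : Type*} {G : SimpleGraph α} {j m : ℕ}

/-- Pairwise disjoint connected sets, consecutive ones being joined by an edge. -/
structure IsPathModel (G : SimpleGraph α) (B : Fin j → Set α) : Prop where
  conn : ∀ i, (G.induce (B i)).Connected
  disj : ∀ i i', i ≠ i' → Disjoint (B i) (B i')
  adj : ∀ i i' : Fin j, (i' : ℕ) = i + 1 → ∃ a ∈ B i, ∃ b ∈ B i', G.Adj a b

/-- The contraction of a path model onto the selected indices `f 0 < f 1 < …`. -/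
def contractPath (B : Fin j → Set α) (f : Fin m → Fin j) (t : Fin m) : Set α :=
  ⋃ i ∈ {i | i ≤ f t ∧ ∀ s < t, f s < i}, B i

variable {B : Fin j → Set α} {f : Fin m → Fin j}

lemma mem_contractPath {t : Fin m} {v : α} :
    v ∈ contractPath B f t ↔ ∃ i, (i ≤ f t ∧ ∀ s < t, f s < i) ∧ v ∈ B i := by
  simp [contractPath]

lemma subset_contractPath (hf : StrictMono f) (t : Fin m) : B (f t) ⊆ contractPath B f t :=
  fun _ hv => mem_contractPath.2 ⟨f t, ⟨le_rfl, fun _ hs => hf hs⟩, hv⟩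

lemma contractPath_subset (t : Fin m) : contractPath B f t ⊆ ⋃ i, B i := fun _ hv =>
  let ⟨i, _, hv⟩ := mem_contractPath.1 hv
  Set.mem_iUnion.2 ⟨i, hv⟩

lemma IsPathModel.contract (hB : IsPathModel G B) (hf : StrictMono f) :
    IsPathModel G (contractPath B f) := by
  refine ⟨fun t => ?_, fun s t hst => ?_, fun s t hst => ?_⟩
  · obtain ⟨a, ha⟩ := induce_connected_nonempty (hB.conn (f t))
    refine induce_connected_of_forall (subset_contractPath hf t ha) fun P hPa hstep => ?_
    have key : ∀ d, ∀ i : Fin j, (i : ℕ) + d = f t → (∀ s < t, f s < i) → ∀ v ∈ B i, P v := by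
      intro d
      induction d with
      | zero =>
        intro i hi hs
        obtain rfl : i = f t := Fin.ext (by omega)
        exact forall_mem_of_induce_connected (hB.conn _) ha hPa fun u hu v hv =>
          hstep u (subset_contractPath hf t hu) v (subset_contractPath hf t hv)
      | succ d ih =>
        intro i hi hs
        have hmem : ∀ i' : Fin j, i ≤ i' → i' ≤ f t → ∀ v ∈ B i', v ∈ contractPath B f t :=
          fun i' h1 h2 v hv =>
            mem_contractPath.2 ⟨i', ⟨h2, fun s hst => (hs s hst).trans_le h1⟩, hv⟩
        let i' : Fin j := ⟨i + 1, by omega⟩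
        have hi' : i ≤ i' := Fin.le_def.2 (by simp [i'])
        have hit : i' ≤ f t := Fin.le_def.2 (by simp only [i']; omega)
        obtain ⟨x, hx, y, hy, hxy⟩ := hB.adj i i' rfl
        have hPy := ih i' (by simp only [i']; omega) (fun s hst => (hs s hst).trans_le hi') y hy
        have hPx := hstep y (hmem i' hi' hit y hy) x (hmem i le_rfl (hi'.trans hit) x hx) hPy
          hxy.symm
        exact forall_mem_of_induce_connected (hB.conn _) hx hPx fun u hu v hv =>
          hstep u (hmem i le_rfl (hi'.trans hit) u hu) v (hmem i le_rfl (hi'.trans hit) v hv)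
    intro v hv
    obtain ⟨i, ⟨hi, hs⟩, hv⟩ := mem_contractPath.1 hv
    exact key (f t - i) i (by have := Fin.le_def.1 hi; omega) hs v hv
  · rw [Set.disjoint_left]
    intro v hv hv'
    obtain ⟨i, ⟨hi, hs⟩, hv⟩ := mem_contractPath.1 hv
    obtain ⟨i', ⟨hi', hs'⟩, hv'⟩ := mem_contractPath.1 hv'
    have : i ≠ i' := by
      rintro rfl
      rcases lt_or_gt_of_ne hst with h | h
      · exact absurd (hs' s h) (not_lt.2 hi)
      · exact absurd (hs t h) (not_lt.2 hi')
    exact Set.disjoint_left.1 (hB.disj i i' this) hv hv'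
  · have hlt : f s < f t := hf (Fin.lt_def.2 (by omega))
    have hlt' := Fin.lt_def.1 hlt
    obtain ⟨x, hx, y, hy, hxy⟩ := hB.adj (f s) ⟨f s + 1, by omega⟩ rfl
    refine ⟨x, subset_contractPath hf s hx, y, mem_contractPath.2 ⟨_, ⟨?_, ?_⟩, hy⟩, hxy⟩
    · exact Fin.le_def.2 (by simp only; omega)
    · intro r hr
      have h1 : f r ≤ f s := hf.monotone (Fin.le_def.2 (by have := Fin.lt_def.1 hr; omega))
      have h2 := Fin.le_def.1 h1
      exact Fin.lt_def.2 (by simp only; omega)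

lemma IsPathModel.comp_rev (hB : IsPathModel G B) : IsPathModel G (B ∘ Fin.rev) := by
  refine ⟨fun i => hB.conn _, fun i i' h => hB.disj _ _ fun h' => h (Fin.rev_injective h'),
    fun i i' h => ?_⟩
  obtain ⟨a, ha, b, hb, hab⟩ := hB.adj i'.rev i.rev (by simp only [Fin.val_rev]; omega)
  exact ⟨b, hb, a, ha, hab.symm⟩

lemma IsPathModel.disjoint_contractPath (hB : IsPathModel G B) {s t : Fin m} (hf : StrictMono f)
    (hst : s ≠ t) : Disjoint (contractPath B f s) (B (f t)) :=
  ((hB.contract hf).disj s t hst).mono_right (subset_contractPath hf t)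

end PathModel

section Reroot

variable {α : Type*} {G : SimpleGraph α} {W C D Z N : Set α} {j m q : ℕ}

/-- The subgraph of all edges with both ends in `Z` but not both in `N`. -/
def restrictTo (G : SimpleGraph α) (Z N : Set α) : SimpleGraph α where
  Adj x y := G.Adj x y ∧ x ∈ Z ∧ y ∈ Z ∧ ¬ (x ∈ N ∧ y ∈ N)
  symm := ⟨fun _ _ h => ⟨h.1.symm, h.2.2.1, h.2.1, fun h' => h.2.2.2 h'.symm⟩⟩
  loopless := ⟨fun _ h => G.loopless.irrefl _ h.1⟩

lemma restrictTo_le : restrictTo G Z N ≤ G := fun _ _ h => h.1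

lemma support_subset_of_restrictTo {a b : α} (p : (restrictTo G Z N).Walk a b) (ha : a ∈ Z) :
    ∀ v ∈ p.support, v ∈ Z := by
  induction p with
  | nil => simpa using ha
  | cons h p ih =>
    intro v hv
    rcases (by simpa using hv : v = _ ∨ v ∈ p.support) with rfl | hv
    · exact ha
    · exact ih h.2.2.1 v hv

lemma walk_last_hit {A : Set α} {a b : α} (p : G.Walk a b) (hp : ∃ v ∈ p.support, v ∈ A) :
    ∃ a' ∈ A, ∃ q : G.Walk a' b, q.support ⊆ p.support ∧ ∀ v ∈ q.support, v ∈ A → v = a' := by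
  induction p with
  | @nil c =>
    obtain ⟨v, hv, hvA⟩ := hp
    obtain rfl : v = c := by simpa using hv
    exact ⟨v, hvA, Walk.nil, by simp, by simp⟩
  | @cons x y z h p ih =>
    by_cases hex : ∃ v ∈ p.support, v ∈ A
    · obtain ⟨a', ha', q, hq, hq'⟩ := ih hex
      exact ⟨a', ha', q, fun v hv => by simp [hq hv], hq'⟩
    · push Not at hex
      obtain ⟨v, hv, hvA⟩ := hp
      rcases (by simpa using hv : v = x ∨ v ∈ p.support) with rfl | hv
      · refine ⟨v, hvA, Walk.cons h p, fun _ h => h, fun w hw hwA => ?_⟩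
        rcases (by simpa using hw : w = v ∨ w ∈ p.support) with rfl | hw
        · rfl
        · exact absurd hwA (hex w hw)
      · exact absurd hvA (hex v hv)

lemma IsBig.inter_nonempty [Finite α] (hC : IsBig G W C) (hD : IsBig G W D) : (C ∩ D).Nonempty := by
  by_contra h
  have hdisj : Disjoint (W ∩ C) (W ∩ D) := by
    rw [Set.disjoint_left]
    exact fun v hv hv' => h ⟨v, hv.2, hv'.2⟩
  have h1 := Set.ncard_union_eq hdisj (Set.toFinite _) (Set.toFinite _)
  have h2 := Set.ncard_le_ncard (s := W ∩ C ∪ W ∩ D) (t := W)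
    (Set.union_subset Set.inter_subset_left Set.inter_subset_left) (Set.toFinite _)
  have := hC.2
  have := hD.2
  omega

/-- A path model whose branch sets `B i` avoid the big set `C` and such that the
neighbourhood of `C` consists of one vertex `u i` of each branch set. -/
structure IsRootedPath (G : SimpleGraph α) (W C : Set α) (B : Fin j → Set α) (u : Fin j → α) :
    Prop where
  big : IsBig G W C
  path : IsPathModel G B
  disj : ∀ i, Disjoint (B i) C
  mem : ∀ i, u i ∈ B i
  nbhd : outerNbhd G C = Set.range u

variable {B : Fin j → Set α} {u : Fin j → α}

lemma IsRootedPath.injective (h : IsRootedPath G W C B u) : Function.Injective u := by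
  intro i i' hii
  by_contra hne
  exact Set.disjoint_left.1 (h.path.disj i i' hne) (h.mem i) (hii ▸ h.mem i')

lemma IsRootedPath.ncard_nbhd (h : IsRootedPath G W C B u) : (outerNbhd G C).ncard = j := by
  rw [h.nbhd, Set.ncard_range_of_injective h.injective, Nat.card_fin]

/-- Rerouting a path model onto the neighbourhood of a smaller big set. -/
theorem IsRootedPath.reroot [Finite α] (h : IsRootedPath G W C B u)
    (hW : ∀ T : Set α, T.ncard ≤ q → ∃ D, IsBig G W D ∧ Disjoint D T ∧ outerNbhd G D ⊆ T)
    (hj : j ≤ q) (hD : IsBig G W D) (hDC : D ⊂ C) (hDj : (outerNbhd G D).ncard ≤ j) :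
    ∃ (m : ℕ) (C' : Set α) (B' : Fin m → Set α) (u' : Fin m → α),
      IsRootedPath G W C' B' u' ∧ C' ⊂ C ∧ m ≤ (outerNbhd G D).ncard := by
  obtain ⟨D1, ⟨hD1, hD1C⟩, hmin⟩ := Set.exists_min_image {D | IsBig G W D ∧ D ⊂ C}
    (fun D => (outerNbhd G D).ncard) (Set.toFinite _) ⟨D, hD, hDC⟩
  have hmD := hmin D ⟨hD, hDC⟩
  obtain ⟨m, hm⟩ : ∃ m, m = (outerNbhd G D1).ncard := ⟨_, rfl⟩
  rw [← hm] at hmin hmD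
  set A := outerNbhd G C with hA
  have hAC : ∀ v ∈ A, v ∉ C := fun v hv => hv.1
  have hND1 : outerNbhd G D1 ⊆ C ∪ A := outerNbhd_subset_union hD1C.subset
  set Z := (C ∪ A) \ D1 with hZ
  have hAZ : ∀ v ∈ A, v ∈ Z := fun v hv => ⟨Or.inr hv, fun h => hAC v hv (hD1C.subset h)⟩
  have hNZ : ∀ v ∈ outerNbhd G D1, v ∈ Z := fun v hv => ⟨hND1 hv, hv.1⟩
  have hlink : HasLinkage (restrictTo G Z ∅) A (outerNbhd G D1) m := by
    refine hasLinkage_of_le_separator _ _ _ _ fun T hT => ?_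
    by_contra! hlt
    obtain ⟨E, hE, hET, hEN⟩ := hW T (by omega)
    obtain ⟨x, hxE, hxD⟩ := hE.inter_nonempty hD1
    have hsep : ∀ y ∈ outerNbhd G D1, ∀ v ∈ A, ∀ p : (restrictTo G Z ∅).Walk y v,
        ∃ w ∈ p.support, w ∈ T := fun y hy v hv p => hT.symm y hy v hv p
    have hP : ∀ v ∈ E, v ∈ D1 ∨ (v ∈ C ∧ ∃ y ∈ outerNbhd G D1,
        ∃ p : (restrictTo G Z ∅).Walk y v, ∀ w ∈ p.support, w ∉ T) := by
      refine forall_mem_of_induce_connected hE.1 hxE (Or.inl hxD) ?_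
      intro a haE b hbE hPa hab
      have hbT : b ∉ T := Set.disjoint_left.1 hET hbE
      by_cases hb : b ∈ D1
      · exact Or.inl hb
      refine Or.inr ?_
      have key : ∃ y ∈ outerNbhd G D1,
          ∃ p : (restrictTo G Z ∅).Walk y b, ∀ w ∈ p.support, w ∉ T := by
        by_cases haD : a ∈ D1
        · exact ⟨b, ⟨hb, a, haD, hab⟩, Walk.nil, by simpa using hbT⟩
        · obtain ⟨haC, y, hy, p, hp⟩ := hPa.resolve_left haD
          have hbZ : b ∈ Z := by
            refine ⟨?_, hb⟩
            by_cases hbC : b ∈ C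
            · exact Or.inl hbC
            · exact Or.inr ⟨hbC, a, haC, hab⟩
          have hadj : (restrictTo G Z ∅).Adj a b := ⟨hab, ⟨Or.inl haC, haD⟩, hbZ, by simp⟩
          refine ⟨y, hy, p.concat hadj, fun w hw => ?_⟩
          rw [Walk.support_concat] at hw
          rcases (by simpa using hw : w ∈ p.support ∨ w = b) with h' | rfl
          · exact hp w h'
          · exact hbT
      obtain ⟨y, hy, p, hp⟩ := key
      refine ⟨?_, y, hy, p, hp⟩
      have hbZ := support_subset_of_restrictTo p (hNZ y hy) b (by simp)
      refine hbZ.1.resolve_right fun hbA => ?_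
      obtain ⟨w, hw, hwT⟩ := hsep y hy b hbA p
      exact hp w hw hwT
    have hEC : E ⊆ C := fun v hv => (hP v hv).elim (fun h => hD1C.subset h) fun h => h.1
    have hcardE := Set.ncard_le_ncard hEN (Set.toFinite _)
    have hne : E ≠ C := by
      rintro rfl
      have := h.ncard_nbhd
      omega
    have := hmin E ⟨hE, hEC.ssubset_of_ne hne⟩
    omega
  obtain ⟨a, b, p, ha, hb, -, hd⟩ := hlink
  choose a' ha' p' hp' ha'' using fun i => walk_last_hit (p i) ⟨a i, by simp, ha i⟩
  obtain ⟨hsurj, huniq⟩ := linkage_eq_end hm.ge hb hd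
  choose idx hidx using fun i => (h.nbhd ▸ ha' i : a' i ∈ Set.range u)
  have hinj : Function.Injective idx := by
    intro s t hst
    by_contra hne
    have : a' s = a' t := by rw [← hidx, ← hidx, hst]
    exact hd s t hne (a' s) (hp' s (by simp)) (hp' t (by rw [this]; simp))
  let τ := Tuple.sort idx
  let f : Fin m → Fin j := idx ∘ τ
  have hf : StrictMono f :=
    (Tuple.monotone_sort idx).strictMono_of_injective (hinj.comp τ.injective)
  have hLZ : ∀ i, ∀ v ∈ (p' i).support, v ∈ Z := fun i =>
    support_subset_of_restrictTo (p' i) (hAZ _ (ha' i))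
  have hBL : ∀ s t, s ≠ t → ∀ v ∈ contractPath B f s, v ∉ (p' (τ t)).support := by
    intro s t hst v hv hvL
    obtain ⟨i, hi⟩ := Set.mem_iUnion.1 (contractPath_subset s hv)
    have hvA : v ∈ A := (hLZ _ v hvL).1.resolve_left (Set.disjoint_left.1 (h.disj i) hi)
    have hva : v = u (f t) := (ha'' _ v hvL hvA).trans (hidx _).symm
    exact Set.disjoint_left.1 (h.path.disjoint_contractPath hf hst) hv (hva ▸ h.mem _)
  have hBf := h.path.contract hf
  refine ⟨m, D1, fun t => contractPath B f t ∪ {v | v ∈ (p' (τ t)).support}, fun t => b (τ t),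
    ⟨hD1, ⟨?_, ?_, ?_⟩, ?_, ?_, ?_⟩, hD1C, hmD⟩
  · intro t
    have h1 := ((p' (τ t)).mapLe restrictTo_le).connected_induce_support
    rw [Walk.support_mapLe_eq_support] at h1
    refine induce_union_connected (hBf.conn t).preconnected h1.preconnected
      ⟨a' (τ t), subset_contractPath hf t ?_, by simp⟩
    rw [← hidx]
    exact h.mem _
  · intro s t hst
    rw [Set.disjoint_left]
    rintro v (hv | hv) (hv' | hv')
    · exact Set.disjoint_left.1 (hBf.disj s t hst) hv hv'
    · exact hBL s t hst v hv hv'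
    · exact hBL t s hst.symm v hv' hv
    · exact hd (τ s) (τ t) (τ.injective.ne hst) v (hp' _ hv) (hp' _ hv')
  · intro s t hst
    obtain ⟨x, hx, y, hy, hxy⟩ := hBf.adj s t hst
    exact ⟨x, Or.inl hx, y, Or.inl hy, hxy⟩
  · intro t
    rw [Set.disjoint_left]
    rintro v (hv | hv) hvD
    · obtain ⟨i, hi⟩ := Set.mem_iUnion.1 (contractPath_subset t hv)
      exact Set.disjoint_left.1 (h.disj i) hi (hD1C.subset hvD)
    · exact (hLZ _ v hv).2 hvD
  · exact fun t => Or.inr (by simp)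
  · ext v
    constructor
    · intro hv
      obtain ⟨i, rfl⟩ := hsurj v hv
      exact ⟨τ.symm i, by simp⟩
    · rintro ⟨t, rfl⟩
      exact hb _

end Reroot

section LinkedPair

variable {α : Type*} {G : SimpleGraph α} {W C D : Set α} {j m q l : ℕ}
  {B : Fin j → Set α} {u : Fin j → α}

lemma exists_isRootedPath_zero (hW : ∀ T : Set α, T.ncard ≤ q →
    ∃ D, IsBig G W D ∧ Disjoint D T ∧ outerNbhd G D ⊆ T) :
    ∃ (C : Set α) (B : Fin 0 → Set α) (u : Fin 0 → α), IsRootedPath G W C B u := by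
  obtain ⟨D, hD, -, hDN⟩ := hW ∅ (by simp)
  refine ⟨D, Fin.elim0, Fin.elim0, hD, ⟨fun i => i.elim0, fun i => i.elim0, fun i => i.elim0⟩,
    fun i => i.elim0, fun i => i.elim0, ?_⟩
  rw [Set.subset_empty_iff.1 hDN, Set.range_eq_empty]

lemma IsRootedPath.exists_ssubset [Finite α] (h : IsRootedPath G W C B u)
    (hW : ∀ T : Set α, T.ncard ≤ q → ∃ D, IsBig G W D ∧ Disjoint D T ∧ outerNbhd G D ⊆ T)
    (hj : j + 1 ≤ q) : ∃ (m : ℕ) (C' : Set α) (B' : Fin m → Set α) (u' : Fin m → α),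
      IsRootedPath G W C' B' u' ∧ C' ⊂ C ∧ m ≤ j + 1 := by
  obtain ⟨w, hwC, hw⟩ : ∃ w ∈ C, ∀ i : Fin j, (i : ℕ) + 1 = j → G.Adj (u i) w := by
    cases j with
    | zero =>
      obtain ⟨w, hw⟩ := induce_connected_nonempty h.big.1
      exact ⟨w, hw, fun i => i.elim0⟩
    | succ k =>
      have : u (Fin.last k) ∈ outerNbhd G C := h.nbhd ▸ Set.mem_range_self _
      obtain ⟨-, w, hw, hadj⟩ := this
      refine ⟨w, hw, fun i hi => ?_⟩
      obtain rfl : i = Fin.last k := Fin.ext (by simp; omega)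
      exact hadj.symm
  have hwN : w ∉ outerNbhd G C := fun h => h.1 hwC
  have hcard : (insert w (outerNbhd G C)).ncard = j + 1 := by
    rw [Set.ncard_insert_of_notMem hwN, h.ncard_nbhd]
  obtain ⟨D, hD, hDT, hDN⟩ := hW _ (hcard.trans_le hj)
  rw [Set.disjoint_right] at hDT
  have hDC : D ⊆ C := subset_of_disjoint_outerNbhd hD.1 (hD.inter_nonempty h.big)
    (Set.disjoint_right.2 fun v hv => hDT (Set.mem_insert_of_mem _ hv))
  have hwD : w ∉ D := hDT (Set.mem_insert _ _)
  have hDC' : D ⊂ C := (Set.ssubset_iff_of_subset hDC).2 ⟨w, hwC, hwD⟩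
  by_cases hlt : (outerNbhd G D).ncard ≤ j
  · obtain ⟨m, C', B', u', h1, h2, h3⟩ := h.reroot hW (by omega) hD hDC' hlt
    exact ⟨m, C', B', u', h1, h2, by omega⟩
  have hND : outerNbhd G D = insert w (outerNbhd G C) :=
    Set.eq_of_subset_of_ncard_le hDN (by omega) (Set.toFinite _)
  refine ⟨j + 1, D, Fin.snoc (α := fun _ => Set α) B {w}, Fin.snoc (α := fun _ => α) u w,
    ⟨hD, ⟨?_, ?_, ?_⟩, ?_, ?_, ?_⟩, hDC', le_rfl⟩
  · refine Fin.lastCases ?_ fun i => ?_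
    · rw [Fin.snoc_last]
      exact induce_connected_of_forall (Set.mem_singleton w) (by rintro P hP - v rfl; exact hP)
    · rw [Fin.snoc_castSucc]; exact h.path.conn i
  · refine Fin.lastCases ?_ fun i => ?_
    · refine Fin.lastCases (fun h => absurd rfl h) fun i _ => ?_
      rw [Fin.snoc_last, Fin.snoc_castSucc, Set.disjoint_singleton_left]
      exact fun hw => Set.disjoint_left.1 (h.disj i) hw hwC
    · refine Fin.lastCases (fun _ => ?_) fun i' hne => ?_
      · rw [Fin.snoc_last, Fin.snoc_castSucc, Set.disjoint_singleton_right]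
        exact fun hw => Set.disjoint_left.1 (h.disj i) hw hwC
      · rw [Fin.snoc_castSucc, Fin.snoc_castSucc]
        exact h.path.disj _ _ fun h => hne (by rw [h])
  · refine Fin.lastCases (fun i hi => ?_) fun i => ?_
    · simp only [Fin.val_last] at hi
      omega
    · refine Fin.lastCases (fun hi => ?_) fun i' hi => ?_
      · rw [Fin.snoc_last, Fin.snoc_castSucc]
        exact ⟨u i, h.mem i, w, rfl, hw i (by simpa using hi.symm)⟩
      · rw [Fin.snoc_castSucc, Fin.snoc_castSucc]
        exact h.path.adj _ _ hi
  · refine Fin.lastCases ?_ fun i => ?_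
    · rw [Fin.snoc_last, Set.disjoint_singleton_left]; exact hwD
    · rw [Fin.snoc_castSucc]; exact (h.disj i).mono_right hDC
  · refine Fin.lastCases ?_ fun i => ?_
    · rw [Fin.snoc_last, Fin.snoc_last]; rfl
    · rw [Fin.snoc_castSucc, Fin.snoc_castSucc]; exact h.mem i
  · rw [hND, h.nbhd, Fin.range_snoc]

/-- Two path models and a matching of their branch sets by further connected sets. -/
structure IsLinkedPair (G : SimpleGraph α) (B B' R : Fin l → Set α) (σ : Fin l → Fin l) : Prop where
  path : IsPathModel G B
  path' : IsPathModel G B'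
  disj : ∀ i i', Disjoint (B i) (B' i')
  conn : ∀ i, (G.induce (R i)).Connected
  disj_link : ∀ i i', i ≠ i' → Disjoint (R i) (R i')
  disj_left : ∀ i i', Disjoint (R i) (B i')
  disj_right : ∀ i i', Disjoint (R i) (B' i')
  adj_left : ∀ i, ∃ a ∈ R i, ∃ b ∈ B i, G.Adj a b
  adj_right : ∀ i, ∃ a ∈ R i, ∃ b ∈ B' (σ i), G.Adj a b
  injective : Function.Injective σ

lemma exists_interior_walk {a b : α} (p : G.Walk a b) (hp : p.IsPath) (hab : a ≠ b)
    (hadj : ¬ G.Adj a b) : ∃ (c d : α) (q : G.Walk c d), G.Adj a c ∧ G.Adj d b ∧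
      (∀ v ∈ q.support, v ∈ p.support) ∧ a ∉ q.support ∧ b ∉ q.support := by
  cases p with
  | nil => exact absurd rfl hab
  | @cons _ c _ h p =>
    cases p with
    | nil => exact absurd h hadj
    | @cons _ e _ h' p =>
      obtain ⟨d, q, h'', hq⟩ := Walk.exists_cons_eq_concat h' p
      rw [hq] at hp
      rw [hq, Walk.support_cons]
      have h1 := (Walk.cons_isPath_iff _ _).1 hp
      have h2 := (Walk.concat_isPath_iff h'').1 h1.1
      have h3 := h1.2
      rw [Walk.support_concat] at h3 ⊢
      refine ⟨c, d, q, h, h'', fun v hv => by simp [hv], fun h => h3 (by simp [h]), h2.2⟩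

lemma IsRootedPath.exists_linkedPair [Finite α] {B : Fin (l + l) → Set α} {u : Fin (l + l) → α}
    (h : IsRootedPath G W C B u)
    (hW : ∀ T : Set α, T.ncard ≤ 3 * l → ∃ D, IsBig G W D ∧ Disjoint D T ∧ outerNbhd G D ⊆ T)
    (hmin : ∀ (m : ℕ) (C' : Set α) (B' : Fin m → Set α) (u' : Fin m → α),
      IsRootedPath G W C' B' u' → C' ⊂ C → l + l ≤ m) :
    ∃ (B B' R : Fin l → Set α) (σ : Fin l → Fin l), IsLinkedPair G B B' R σ := by
  set N := outerNbhd G C with hN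
  let x : Fin l → α := fun i => u (Fin.castAdd l i)
  let y : Fin l → α := fun i => u (Fin.natAdd l i)
  have hxN : ∀ i, x i ∈ N := fun i => by rw [hN, h.nbhd]; exact Set.mem_range_self _
  have hyN : ∀ i, y i ∈ N := fun i => by rw [hN, h.nbhd]; exact Set.mem_range_self _
  have hxinj : Function.Injective x := h.injective.comp (Fin.castAdd_injective _ _)
  have hyinj : Function.Injective y := h.injective.comp (Fin.natAdd_injective _ _)
  have hne : ∀ i i', Fin.castAdd l i ≠ Fin.natAdd l i' := fun i i' h => by
    have := congrArg Fin.val h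
    simp only [Fin.val_castAdd, Fin.val_natAdd] at this
    omega
  have hNxy : ∀ v ∈ N, v ∈ Set.range x ∨ v ∈ Set.range y := by
    intro v hv
    rw [hN, h.nbhd] at hv
    obtain ⟨i, rfl⟩ := hv
    refine Fin.addCases (fun i => ?_) (fun i => ?_) i
    · exact Or.inl ⟨i, rfl⟩
    · exact Or.inr ⟨i, rfl⟩
  have hcx : (Set.range x).ncard = l := by rw [Set.ncard_range_of_injective hxinj, Nat.card_fin]
  have hcy : (Set.range y).ncard = l := by rw [Set.ncard_range_of_injective hyinj, Nat.card_fin]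
  have hCN : ∀ v ∈ C, v ∉ N := fun v hv h => h.1 hv
  set G' := restrictTo G (C ∪ N) N with hG'
  have hG'C : ∀ v ∈ C, ∀ w ∈ C ∪ N, G.Adj v w → G'.Adj v w := fun v hv w hw hvw =>
    ⟨hvw, Or.inl hv, hw, fun h => hCN v hv h.1⟩
  have hlink : HasLinkage G' (Set.range x) (Set.range y) l := by
    refine hasLinkage_of_le_separator _ _ _ _ fun T hT => ?_
    by_contra! hlt
    have hTN : (T ∪ N).ncard ≤ 3 * l := by
      have h1 := Set.ncard_union_le T N
      have h2 := h.ncard_nbhd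
      rw [← hN] at h2
      omega
    obtain ⟨D, hD, hDT, hDN⟩ := hW _ hTN
    rw [Set.disjoint_union_right] at hDT
    have hDC : D ⊆ C := subset_of_disjoint_outerNbhd hD.1 (hD.inter_nonempty h.big) hDT.2
    have key : outerNbhd G D ⊆ T ∪ Set.range x ∨ outerNbhd G D ⊆ T ∪ Set.range y := by
      by_contra! hcon
      obtain ⟨h1, h2⟩ := hcon
      rw [Set.not_subset] at h1 h2
      obtain ⟨b, hbD, hb⟩ := h1
      obtain ⟨a, haD, ha⟩ := h2
      simp only [Set.mem_union, not_or] at ha hb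
      have haN : a ∈ N := (hDN haD).resolve_left ha.1
      have hbN : b ∈ N := (hDN hbD).resolve_left hb.1
      have hax := (hNxy a haN).resolve_right ha.2
      have hby := (hNxy b hbN).resolve_left hb.2
      obtain ⟨-, a', ha', haa⟩ := haD
      obtain ⟨-, b', hb', hbb⟩ := hbD
      have hstart : G'.Adj a a' := (hG'C a' (hDC ha') a (Or.inr haN) haa).symm
      have hend : G'.Adj b' b := hG'C b' (hDC hb') b (Or.inr hbN) hbb
      obtain ⟨p, hp⟩ : ∃ p : G'.Walk a b', ∀ w ∈ p.support, w ∉ T := by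
        refine forall_mem_of_induce_connected hD.1 ha' (P := fun v =>
          ∃ p : G'.Walk a v, ∀ w ∈ p.support, w ∉ T) ?_ ?_ b' hb'
        · refine ⟨hstart.toWalk, fun w hw => ?_⟩
          rcases (by simpa using hw : w = a ∨ w = a') with rfl | rfl
          · exact ha.1
          · exact Set.disjoint_left.1 hDT.1 ha'
        · rintro v hv w hw ⟨p, hp⟩ hvw
          have hadj := hG'C v (hDC hv) w (Or.inl (hDC hw)) hvw
          refine ⟨p.concat hadj, fun z hz => ?_⟩
          rw [Walk.support_concat] at hz
          rcases (by simpa using hz : z ∈ p.support ∨ z = w) with h' | rfl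
          · exact hp z h'
          · exact Set.disjoint_left.1 hDT.1 hw
      obtain ⟨w, hw, hwT⟩ := hT a hax b hby (p.concat hend)
      rw [Walk.support_concat] at hw
      rcases (by simpa using hw : w ∈ p.support ∨ w = b) with h' | rfl
      · exact hp w h' hwT
      · exact hb.1 hwT
    have hDcard : (outerNbhd G D).ncard + 1 ≤ l + l := by
      rcases key with hk | hk
      · have h1 := Set.ncard_le_ncard hk (Set.toFinite _)
        have h2 := Set.ncard_union_le T (Set.range x)
        omega
      · have h1 := Set.ncard_le_ncard hk (Set.toFinite _)
        have h2 := Set.ncard_union_le T (Set.range y)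
        omega
    have hDne : D ≠ C := by
      rintro rfl
      have := h.ncard_nbhd
      omega
    obtain ⟨m, C', B', u', h1, h2, h3⟩ := h.reroot hW (by omega) hD (hDC.ssubset_of_ne hDne)
      (by omega)
    have := hmin m C' B' u' h1 h2
    omega
  obtain ⟨a, b, p, ha, hb, hp, hd⟩ := hlink
  obtain ⟨-, hby⟩ := linkage_eq_end hcy.le hb hd
  obtain ⟨-, hax⟩ := linkage_eq_end (p := fun i => (p i).reverse) hcx.le ha
    (fun i j hij v => by simpa using hd i j hij v)
  simp only [Walk.support_reverse, List.mem_reverse] at hax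
  choose f hf using ha
  choose g hg using hb
  have hdne : ∀ i j, a i = a j → i = j := fun i j hij => by
    by_contra hne
    exact hd i j hne (a i) (by simp) (by rw [hij]; simp)
  have hdne' : ∀ i j, b i = b j → i = j := fun i j hij => by
    by_contra hne
    exact hd i j hne (b i) (by simp) (by rw [hij]; simp)
  have hfinj : Function.Injective f := fun i j hij => hdne i j (by rw [← hf, ← hf, hij])
  have hginj : Function.Injective g := fun i j hij => hdne' i j (by rw [← hg, ← hg, hij])
  have haN : ∀ i, a i ∈ N := fun i => hf i ▸ hxN _
  have hbN : ∀ i, b i ∈ N := fun i => hg i ▸ hyN _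
  choose c d r hac hdb hrp har hbr using fun i => exists_interior_walk (p i) (hp i)
    (by rw [← hf, ← hg]; exact fun hh => hne _ _ (h.injective hh))
    (fun hh => hh.2.2.2 ⟨haN i, hbN i⟩)
  have hrC : ∀ i, ∀ v ∈ (r i).support, v ∈ C := by
    intro i v hv
    refine (support_subset_of_restrictTo (p i) (Or.inr (haN i)) v (hrp i v hv)).resolve_right ?_
    intro hvN
    rcases hNxy v hvN with hvx | hvy
    · exact har i (hax i v (hrp i v hv) hvx ▸ hv)
    · exact hbr i (hby i v (hrp i v hv) hvy ▸ hv)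
  let e : Fin l ≃ Fin l := Equiv.ofBijective f (Finite.injective_iff_bijective.1 hfinj)
  have hfe : ∀ i, f (e.symm i) = i := fun i => e.apply_symm_apply i
  refine ⟨fun i => B (Fin.castAdd l i), fun i => B (Fin.natAdd l i),
    fun i => {v | v ∈ (r (e.symm i)).support}, g ∘ e.symm, ⟨?_, ?_, ?_, ?_, ?_, ?_, ?_, ?_, ?_, ?_⟩⟩
  · exact ⟨fun i => h.path.conn _, fun i i' hii => h.path.disj _ _
      fun hh => hii (Fin.castAdd_injective _ _ hh), fun i i' hii => h.path.adj _ _ hii⟩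
  · exact ⟨fun i => h.path.conn _, fun i i' hii => h.path.disj _ _
      fun hh => hii (Fin.natAdd_injective _ _ hh), fun i i' hii => h.path.adj _ _ (by
        simp only [Fin.val_natAdd]; omega)⟩
  · exact fun i i' => h.path.disj _ _ (hne i i')
  · intro i
    have h1 := ((r (e.symm i)).mapLe restrictTo_le).connected_induce_support
    rwa [Walk.support_mapLe_eq_support] at h1
  · intro i i' hii
    rw [Set.disjoint_left]
    exact fun v hv hv' => hd _ _ (e.symm.injective.ne hii) v (hrp _ v hv) (hrp _ v hv')
  · intro i i'
    exact Set.disjoint_right.2 fun v hv hv' => Set.disjoint_left.1 (h.disj _) hv (hrC _ v hv')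
  · intro i i'
    exact Set.disjoint_right.2 fun v hv hv' => Set.disjoint_left.1 (h.disj _) hv (hrC _ v hv')
  · intro i
    refine ⟨c (e.symm i), by simp, a (e.symm i), ?_, (hac _).1.symm⟩
    rw [← hf, hfe]
    exact h.mem _
  · intro i
    refine ⟨d (e.symm i), by simp, b (e.symm i), ?_, (hdb _).1⟩
    rw [← hg]
    exact h.mem _
  · exact hginj.comp e.symm.injective

theorem exists_linkedPair_of_exists_big [Finite α] (hl : 0 < l)
    (hW : ∀ T : Set α, T.ncard ≤ 3 * l → ∃ D, IsBig G W D ∧ Disjoint D T ∧ outerNbhd G D ⊆ T) :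
    ∃ (B B' R : Fin l → Set α) (σ : Fin l → Fin l), IsLinkedPair G B B' R σ := by
  obtain ⟨C₀, hC₀⟩ := exists_minimal_of_wellFoundedLT (fun C : Set α => ∃ (m : ℕ)
    (B : Fin m → Set α) (u : Fin m → α), IsRootedPath G W C B u ∧ m < l + l) (by
      obtain ⟨C, B, u, h⟩ := exists_isRootedPath_zero hW
      exact ⟨C, 0, B, u, h, by omega⟩)
  obtain ⟨⟨j, B, u, h, hj⟩, hmin⟩ := hC₀
  have hmin' : ∀ (m : ℕ) (C' : Set α) (B' : Fin m → Set α) (u' : Fin m → α),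
      IsRootedPath G W C' B' u' → C' ⊂ C₀ → l + l ≤ m := by
    intro m C' B' u' h' hlt
    by_contra! hm
    exact hlt.2 (hmin ⟨m, B', u', h', hm⟩ hlt.1)
  obtain ⟨m, C, B', u', h', hC, hm⟩ := h.exists_ssubset hW (by omega)
  obtain rfl : m = l + l := le_antisymm (by omega) (hmin' m C B' u' h' hC)
  exact h'.exists_linkedPair hW fun m D B u h hlt => hmin' m D B u h (hlt.trans hC)

end LinkedPair

section XiMinor

/-- Erdős–Szekeres: an injective sequence of length `n * n` has a monotone subsequence
of length `n`. -/
lemma exists_strictMono_or_strictAnti {n N : ℕ} (hn : 0 < n) (hN : n * n ≤ N) (σ : Fin N → Fin N)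
    (hσ : Function.Injective σ) :
    ∃ f : Fin n → Fin N, StrictMono f ∧ (StrictMono (σ ∘ f) ∨ StrictAnti (σ ∘ f)) := by
  classical
  obtain ⟨n, rfl⟩ : ∃ k, n = k + 1 := ⟨n - 1, by omega⟩
  let Inc : Fin N → ℕ → Prop := fun i m => ∃ f : Fin (m + 1) → Fin N,
    StrictMono f ∧ StrictMono (σ ∘ f) ∧ f (Fin.last m) = i
  have hInc0 : ∀ i, Inc i 0 := fun i => ⟨fun _ => i,
    fun s t h => absurd (Subsingleton.elim (α := Fin 1) s t) h.ne,
    fun s t h => absurd (Subsingleton.elim (α := Fin 1) s t) h.ne, rfl⟩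
  by_cases hlong : ∃ i, Inc i n
  · obtain ⟨i, f, hf, hσf, -⟩ := hlong
    exact ⟨f, hf, Or.inl hσf⟩
  push Not at hlong
  let L : Fin N → ℕ := fun i => Nat.findGreatest (Inc i) n
  have hL : ∀ i, Inc i (L i) := fun i => Nat.findGreatest_spec (Nat.zero_le n) (hInc0 i)
  have hLn : ∀ i, L i < n := fun i => lt_of_le_of_ne (Nat.findGreatest_le n) fun h =>
    hlong i (h ▸ hL i)
  have hstep : ∀ i i', i < i' → σ i < σ i' → L i < L i' := by
    intro i i' hlt hσlt
    obtain ⟨f, hf, hσf, hfi⟩ := hL i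
    refine Nat.lt_of_succ_le (Nat.le_findGreatest (hLn i) ⟨Fin.snoc (α := fun _ => Fin N) f i',
      ?_, ?_, by rw [Fin.snoc_last]⟩)
    · rw [Fin.strictMono_iff_lt_succ]
      refine Fin.lastCases ?_ fun t => ?_
      · rw [Fin.succ_last, Fin.snoc_last, Fin.snoc_castSucc, hfi]; exact hlt
      · rw [Fin.succ_castSucc, Fin.snoc_castSucc, Fin.snoc_castSucc]
        exact hf Fin.castSucc_lt_succ
    · rw [Fin.strictMono_iff_lt_succ]
      refine Fin.lastCases ?_ fun t => ?_
      · simp only [Function.comp]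
        rw [Fin.succ_last, Fin.snoc_last, Fin.snoc_castSucc, hfi]; exact hσlt
      · simp only [Function.comp]
        rw [Fin.succ_castSucc, Fin.snoc_castSucc, Fin.snoc_castSucc]
        exact hσf Fin.castSucc_lt_succ
  obtain ⟨c, -, hc⟩ := Finset.exists_lt_card_fiber_of_mul_lt_card_of_maps_to
    (s := (Finset.univ : Finset (Fin N))) (t := Finset.range n) (f := L) (n := n)
    (fun i _ => Finset.mem_range.2 (hLn i)) (by
      rw [Finset.card_range, Finset.card_univ, Fintype.card_fin]
      nlinarith)
  let f := Finset.orderEmbOfCardLe _ hc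
  have hf : ∀ t, L (f t) = c := fun t =>
    (Finset.mem_filter.1 (Finset.orderEmbOfCardLe_mem _ hc t)).2
  refine ⟨f, f.strictMono, Or.inr fun s t hst => ?_⟩
  have hlt : f s < f t := f.strictMono hst
  rcases lt_trichotomy (σ (f s)) (σ (f t)) with h | h | h
  · have := hstep _ _ hlt h
    rw [hf, hf] at this
    omega
  · exact absurd (hσ h) hlt.ne
  · exact h

variable {α : Type*} {G : SimpleGraph α} {l n : ℕ} {B B' R : Fin l → Set α} {σ : Fin l → Fin l}

lemma IsLinkedPair.comp_rev (h : IsLinkedPair G B B' R σ) :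
    IsLinkedPair G B (B' ∘ Fin.rev) R (Fin.rev ∘ σ) where
  path := h.path
  path' := h.path'.comp_rev
  disj _ _ := h.disj _ _
  conn := h.conn
  disj_link := h.disj_link
  disj_left := h.disj_left
  disj_right _ _ := h.disj_right _ _
  adj_left := h.adj_left
  adj_right i := by simpa using h.adj_right i
  injective := Fin.rev_injective.comp h.injective

lemma xi_adj_iff {r : ℕ} {a b : Fin 3 × Fin r} : (Xi r).Adj a b ↔ a ≠ b ∧
    (((a.1 = 0 ∧ b.1 = 0 ∧ (b.2 : ℕ) = (a.2 : ℕ) + 1) ∨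
      (a.1 = 2 ∧ b.1 = 2 ∧ (b.2 : ℕ) = (a.2 : ℕ) + 1) ∨
      (a.1 = 1 ∧ a.2 = b.2 ∧ (b.1 = 0 ∨ b.1 = 2))) ∨
    ((b.1 = 0 ∧ a.1 = 0 ∧ (a.2 : ℕ) = (b.2 : ℕ) + 1) ∨
      (b.1 = 2 ∧ a.1 = 2 ∧ (a.2 : ℕ) = (b.2 : ℕ) + 1) ∨
      (b.1 = 1 ∧ b.2 = a.2 ∧ (a.1 = 0 ∨ a.1 = 2)))) :=
  SimpleGraph.fromRel_adj _ _ _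

lemma IsLinkedPair.isMinor_xi_of_strictMono (h : IsLinkedPair G B B' R σ) {f : Fin n → Fin l}
    (hf : StrictMono f) (hσf : StrictMono (σ ∘ f)) : IsMinor (Xi n) G := by
  have h1 := h.path.contract hf
  have h2 := h.path'.contract hσf
  have hd : ∀ s t, Disjoint (contractPath B f s) (contractPath B' (σ ∘ f) t) := fun s t => by
    refine Disjoint.mono (contractPath_subset s) (contractPath_subset t) ?_
    simp only [Set.disjoint_iUnion_left, Set.disjoint_iUnion_right]
    exact fun i i' => h.disj _ _
  have hl : ∀ s t, Disjoint (R s) (contractPath B f t) := fun s t => by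
    refine Disjoint.mono_right (contractPath_subset t) ?_
    simp only [Set.disjoint_iUnion_right]
    exact fun i => h.disj_left _ _
  have hr : ∀ s t, Disjoint (R s) (contractPath B' (σ ∘ f) t) := fun s t => by
    refine Disjoint.mono_right (contractPath_subset t) ?_
    simp only [Set.disjoint_iUnion_right]
    exact fun i => h.disj_right _ _
  let M : Fin 3 × Fin n → Set α := fun p =>
    ![contractPath B f p.2, R (f p.2), contractPath B' (σ ∘ f) p.2] p.1
  refine ⟨M, ?_, ?_, ?_⟩
  · rintro ⟨i, t⟩
    fin_cases i
    · exact h1.conn t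
    · exact h.conn _
    · exact h2.conn t
  · rintro ⟨i, s⟩ ⟨i', t⟩ hne
    have hst : i = i' → s ≠ t := fun hi hs => hne (by rw [hi, hs])
    fin_cases i <;> fin_cases i'
    · exact h1.disj s t (hst rfl)
    · exact (hl _ _).symm
    · exact hd _ _
    · exact hl _ _
    · exact h.disj_link _ _ (hf.injective.ne (hst rfl))
    · exact hr _ _
    · exact (hd _ _).symm
    · exact (hr _ _).symm
    · exact h2.disj s t (hst rfl)
  · have key : ∀ a b : Fin 3 × Fin n, ((a.1 = 0 ∧ b.1 = 0 ∧ (b.2 : ℕ) = (a.2 : ℕ) + 1) ∨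
        (a.1 = 2 ∧ b.1 = 2 ∧ (b.2 : ℕ) = (a.2 : ℕ) + 1) ∨
        (a.1 = 1 ∧ a.2 = b.2 ∧ (b.1 = 0 ∨ b.1 = 2))) →
        ∃ x ∈ M a, ∃ y ∈ M b, G.Adj x y := by
      rintro ⟨i, s⟩ ⟨i', t⟩ hab
      simp only at hab
      rcases hab with ⟨rfl, rfl, hst⟩ | ⟨rfl, rfl, hst⟩ | ⟨rfl, rfl, rfl | rfl⟩
      · exact h1.adj s t hst
      · exact h2.adj s t hst
      · obtain ⟨x, hx, y, hy, hxy⟩ := h.adj_left (f s)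
        exact ⟨x, hx, y, subset_contractPath hf s hy, hxy⟩
      · obtain ⟨x, hx, y, hy, hxy⟩ := h.adj_right (f s)
        exact ⟨x, hx, y, subset_contractPath hσf s hy, hxy⟩
    intro a b hab
    rcases (xi_adj_iff.1 hab).2 with hab | hab
    · exact key a b hab
    · obtain ⟨x, hx, y, hy, hxy⟩ := key b a hab
      exact ⟨y, hy, x, hx, hxy.symm⟩

theorem IsLinkedPair.isMinor_xi (h : IsLinkedPair G B B' R σ) (hn : 0 < n) (hl : n * n ≤ l) :
    IsMinor (Xi n) G := by
  obtain ⟨f, hf, hσ | hσ⟩ := exists_strictMono_or_strictAnti hn hl σ h.injective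
  · exact h.isMinor_xi_of_strictMono hf hσ
  · exact h.comp_rev.isMinor_xi_of_strictMono hf fun s t hst => Fin.rev_lt_rev.2 (hσ hst)

/-- A graph of treewidth at least `12 * n ^ 2` contains the graph `Xi n` as a minor. -/
theorem isMinor_xi_of_le_treewidth [Finite α] (hn : 0 < n) (h : 12 * (n * n) ≤ treewidth G) :
    IsMinor (Xi n) G := by
  have hpos : 0 < n * n := Nat.mul_pos hn hn
  obtain ⟨W, hW⟩ := exists_big_component_of_le_treewidth (G := G) (q := 3 * (n * n)) (by omega)
    (by omega)
  obtain ⟨B, B', R, σ, hl⟩ := exists_linkedPair_of_exists_big hpos hW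
  exact hl.isMinor_xi hn le_rfl

end XiMinor

section Pathwidth

/-- If `act i j` says that `i < j` is still alive when `j` appears and at most two indices are
alive at any time, then two tracks suffice to keep track of the alive indices. -/
lemma exists_tracks {act : ℕ → ℕ → Prop}
    (hmono : ∀ i j k, i < j → j < k → act i k → act i j)
    (htwo : ∀ i₁ i₂ i j, i₁ < i₂ → i₂ < j → i < j → act i₁ j → act i₂ j → act i j →
      i = i₁ ∨ i = i₂) :
    ∃ a b : ℕ → ℕ, a 0 = 0 ∧ b 0 = 0 ∧ (∀ j, a (j + 1) = a j ∨ a (j + 1) = j + 1) ∧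
      (∀ j, b (j + 1) = b j ∨ b (j + 1) = j + 1) ∧
      ∀ i j, i ≤ j → act i (j + 1) → i = a j ∨ i = b j := by
  have step : ∀ (j : ℕ) (p : ℕ × ℕ), ∃ p' : ℕ × ℕ, (p'.1 = p.1 ∨ p'.1 = j + 1) ∧
      (p'.2 = p.2 ∨ p'.2 = j + 1) ∧ ((∀ i ≤ j, act i (j + 1) → i = p.1 ∨ i = p.2) →
        ∀ i ≤ j + 1, act i (j + 2) → i = p'.1 ∨ i = p'.2) := by
    rintro j ⟨a, b⟩
    by_cases hnew : act (j + 1) (j + 2)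
    · by_cases hold : act a (j + 2) ∧ a ≤ j
      · refine ⟨(a, j + 1), Or.inl rfl, Or.inr rfl, fun _ i hi h => ?_⟩
        exact htwo a (j + 1) i (j + 2) (by omega) (by omega) (by omega) hold.1 hnew h
      · refine ⟨(j + 1, b), Or.inr rfl, Or.inl rfl, fun hinv i hi h => ?_⟩
        rcases Nat.lt_or_ge i (j + 1) with hij | hij
        · rcases hinv i (by omega) (hmono i (j + 1) (j + 2) hij (by omega) h) with rfl | rfl
          · exact absurd ⟨h, by omega⟩ hold
          · exact Or.inr rfl
        · exact Or.inl (by simp only; omega)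
    · refine ⟨(a, b), Or.inl rfl, Or.inl rfl, fun hinv i hi h => ?_⟩
      rcases Nat.lt_or_ge i (j + 1) with hij | hij
      · exact hinv i (by omega) (hmono i (j + 1) (j + 2) hij (by omega) h)
      · obtain rfl : i = j + 1 := by omega
        exact absurd h hnew
  choose nxt h1 h2 h3 using step
  let g : ℕ → ℕ × ℕ := fun j => Nat.rec (0, 0) nxt j
  refine ⟨fun j => (g j).1, fun j => (g j).2, rfl, rfl, fun j => h1 j (g j), fun j => h2 j (g j),
    fun i j => ?_⟩
  induction j generalizing i with
  | zero => exact fun hi _ => Or.inl (Nat.le_zero.1 hi)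
  | succ j ih => exact fun hi h => h3 j (g j) (fun i hi h => ih i hi h) i hi h

/-- A graph on `Fin r` all of whose edges join simultaneously alive vertices, at most two being
alive at any time, is a minor of `Xi r`. -/
lemma isMinor_xi_of_act {r : ℕ} {H : SimpleGraph (Fin r)} {act : ℕ → ℕ → Prop}
    (hmono : ∀ i j k, i < j → j < k → act i k → act i j)
    (htwo : ∀ i₁ i₂ i j, i₁ < i₂ → i₂ < j → i < j → act i₁ j → act i₂ j → act i j →
      i = i₁ ∨ i = i₂)
    (hH : ∀ i j, i < j → H.Adj i j → act i j) : IsMinor H (Xi r) := by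
  obtain ⟨a, b, ha0, hb0, ha, hb, hab⟩ := exists_tracks hmono htwo
  let own : Fin 3 × Fin r → ℕ := fun p => ![a p.2, p.2, b p.2] p.1
  let M : Fin r → Set (Fin 3 × Fin r) := fun v => {p | own p = v}
  refine ⟨M, fun v => ?_, fun u v huv => ?_, ?_⟩
  · refine induce_connected_of_forall (a := (1, v)) (show own (1, v) = v from rfl) ?_
    intro P hP hstep
    have hx : ∀ i (hi : i < r), a i = v → P (0, ⟨i, hi⟩) := by
      intro i
      induction i with
      | zero =>
        intro hi hv
        refine hstep (1, v) rfl (0, ⟨0, hi⟩) hv hP (xi_adj_iff.2 ⟨by simp, Or.inl ?_⟩)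
        exact Or.inr (Or.inr ⟨rfl, Fin.ext (by simp only; omega), Or.inl rfl⟩)
      | succ i ih =>
        intro hi hv
        rcases ha i with h | h
        · have hv' : a i = v := by omega
          exact hstep (0, ⟨i, by omega⟩) hv' (0, ⟨i + 1, hi⟩) hv (ih _ hv')
            (xi_adj_iff.2 ⟨by simp, Or.inl (Or.inl ⟨rfl, rfl, rfl⟩)⟩)
        · refine hstep (1, v) rfl (0, ⟨i + 1, hi⟩) hv hP (xi_adj_iff.2 ⟨by simp, Or.inl ?_⟩)
          exact Or.inr (Or.inr ⟨rfl, Fin.ext (by simp only; omega), Or.inl rfl⟩)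
    have hz : ∀ i (hi : i < r), b i = v → P (2, ⟨i, hi⟩) := by
      intro i
      induction i with
      | zero =>
        intro hi hv
        refine hstep (1, v) rfl (2, ⟨0, hi⟩) hv hP (xi_adj_iff.2 ⟨by simp, Or.inl ?_⟩)
        exact Or.inr (Or.inr ⟨rfl, Fin.ext (by simp only; omega), Or.inr rfl⟩)
      | succ i ih =>
        intro hi hv
        rcases hb i with h | h
        · have hv' : b i = v := by omega
          exact hstep (2, ⟨i, by omega⟩) hv' (2, ⟨i + 1, hi⟩) hv (ih _ hv')
            (xi_adj_iff.2 ⟨by simp, Or.inl (Or.inr (Or.inl ⟨rfl, rfl, rfl⟩))⟩)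
        · refine hstep (1, v) rfl (2, ⟨i + 1, hi⟩) hv hP (xi_adj_iff.2 ⟨by simp, Or.inl ?_⟩)
          exact Or.inr (Or.inr ⟨rfl, Fin.ext (by simp only; omega), Or.inr rfl⟩)
    rintro ⟨c, i⟩ hi
    fin_cases c
    · exact hx i i.2 hi
    · obtain rfl : i = v := Fin.ext hi
      exact hP
    · exact hz i i.2 hi
  · exact Set.disjoint_left.2 fun p hu hv => huv (Fin.ext (hu.symm.trans hv))
  · have key : ∀ u v : Fin r, u < v → H.Adj u v → ∃ x ∈ M u, ∃ y ∈ M v, (Xi r).Adj x y := by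
      rintro ⟨i, hi⟩ ⟨j, hj⟩ hlt hadj
      have hlt' : i < j := hlt
      obtain ⟨k, rfl⟩ : ∃ k, j = k + 1 := ⟨j - 1, by omega⟩
      rcases hab i k (by omega) (hH _ _ hlt hadj) with h | h
      · rcases ha k with h' | h'
        · exact ⟨(0, ⟨k + 1, hj⟩), h'.trans h.symm, (1, ⟨k + 1, hj⟩), rfl,
            xi_adj_iff.2 ⟨by simp, Or.inr (Or.inr (Or.inr ⟨rfl, rfl, Or.inl rfl⟩))⟩⟩
        · exact ⟨(0, ⟨k, by omega⟩), h.symm, (0, ⟨k + 1, hj⟩), h',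
            xi_adj_iff.2 ⟨by simp, Or.inl (Or.inl ⟨rfl, rfl, rfl⟩)⟩⟩
      · rcases hb k with h' | h'
        · exact ⟨(2, ⟨k + 1, hj⟩), h'.trans h.symm, (1, ⟨k + 1, hj⟩), rfl,
            xi_adj_iff.2 ⟨by simp, Or.inr (Or.inr (Or.inr ⟨rfl, rfl, Or.inr rfl⟩))⟩⟩
        · exact ⟨(2, ⟨k, by omega⟩), h.symm, (2, ⟨k + 1, hj⟩), h',
            xi_adj_iff.2 ⟨by simp, Or.inl (Or.inr (Or.inl ⟨rfl, rfl, rfl⟩))⟩⟩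
    intro u v huv
    rcases lt_or_gt_of_ne huv.ne with h | h
    · exact key u v h huv
    · obtain ⟨x, hx, y, hy, hxy⟩ := key v u h huv.symm
      exact ⟨y, hy, x, hx, hxy.symm⟩

variable {β : Type*} {H : SimpleGraph β}

lemma exists_pathDecomp [Finite β] (H : SimpleGraph β) : ∃ (n : ℕ) (X : Fin (n + 1) → Set β),
    IsTreeDecomp H (pathGraph (n + 1)) X ∧ ∀ t, (X t).ncard ≤ pathwidth H + 1 := by
  refine Nat.sInf_mem (s := {w | ∃ (n : ℕ) (X : Fin (n + 1) → Set β),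
    IsTreeDecomp H (pathGraph (n + 1)) X ∧ ∀ t, (X t).ncard ≤ w + 1})
    ⟨Nat.card β, 0, fun _ => Set.univ, ⟨fun v => ⟨0, trivial⟩, fun u v _ => ⟨0, trivial, trivial⟩,
      fun v => induce_connected_of_forall (a := 0) trivial fun P hP _ t _ => ?_⟩, fun t => ?_⟩
  · rwa [Subsingleton.elim (α := Fin 1) t 0]
  · rw [Set.ncard_univ]
    omega

lemma IsTreeDecomp.mem_of_mem_of_mem {n : ℕ} {X : Fin n → Set β}
    (h : IsTreeDecomp H (pathGraph n) X) {v : β} {s t u : Fin n} (hst : s ≤ t) (htu : t ≤ u)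
    (hs : v ∈ X s) (hu : v ∈ X u) : v ∈ X t := by
  by_contra ht
  have hne : ∀ w, v ∈ X w → w ≠ t := fun w hw hwt => ht (hwt ▸ hw)
  have := forall_mem_of_induce_connected (h.2.2 v) (P := fun w => w < t) hs
    (lt_of_le_of_ne hst (hne s hs)) (fun x _ y hy hx hxy => ?_) u hu
  · exact absurd this (not_lt.2 htu)
  · refine lt_of_le_of_ne ?_ (hne y hy)
    have hx := Fin.lt_def.1 hx
    rcases pathGraph_adj.1 hxy with h | h
    · exact Fin.le_def.2 (by omega)
    · exact Fin.le_def.2 (by omega)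

/-- Every graph on `r` vertices of pathwidth at most `2` is a minor of `Xi r`. -/
theorem isMinor_xi_of_pathwidth_le [Fintype β] {r : ℕ} (hcard : Fintype.card β = r)
    (hpw : pathwidth H ≤ 2) : IsMinor H (Xi r) := by
  classical
  obtain ⟨n, X, hX, hXcard⟩ := exists_pathDecomp H
  have hs : ∀ v, ∃ t, v ∈ X t ∧ ∀ t', v ∈ X t' → t ≤ t' := fun v =>
    Set.exists_min_image {t | v ∈ X t} id (Set.toFinite _) (hX.1 v)
  choose s hsX hsmin using hs
  let e := (Fintype.equivFinOfCardEq hcard).symm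
  let c : Fin r ≃ β := (Tuple.sort (s ∘ e)).trans e
  have hc : Monotone (s ∘ c) := Tuple.monotone_sort (s ∘ e)
  let act : ℕ → ℕ → Prop := fun i j => ∃ (hi : i < r) (hj : j < r), c ⟨i, hi⟩ ∈ X (s (c ⟨j, hj⟩))
  have hminor : IsMinor (H.comap c) (Xi r) := by
    refine isMinor_xi_of_act (act := act) ?_ ?_ ?_
    · rintro i j k hij hjk ⟨hi, hk, h⟩
      exact ⟨hi, by omega, hX.mem_of_mem_of_mem (hc (Fin.le_def.2 hij.le))
        (hc (Fin.le_def.2 (show j ≤ k from hjk.le))) (hsX _) h⟩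
    · rintro i₁ i₂ i j h12 h2j hij ⟨hi₁, hj, h₁⟩ ⟨hi₂, _, h₂⟩ ⟨hi, _, h⟩
      by_contra! hne
      let S : Finset (Fin r) := {⟨i₁, hi₁⟩, ⟨i₂, hi₂⟩, ⟨i, hi⟩, ⟨j, hj⟩}
      have hS : S.card = 4 := by
        rw [Finset.card_insert_of_notMem, Finset.card_insert_of_notMem,
          Finset.card_insert_of_notMem, Finset.card_singleton] <;>
        simp only [Finset.mem_insert, Finset.mem_singleton, Fin.mk.injEq, not_or] <;> omega
      have hsub : ((S.map c.toEmbedding : Finset β) : Set β) ⊆ X (s (c ⟨j, hj⟩)) := by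
        intro v hv
        obtain ⟨t, ht, rfl⟩ := Finset.mem_map.1 (Finset.mem_coe.1 hv)
        simp only [S, Finset.mem_insert, Finset.mem_singleton] at ht
        rcases ht with rfl | rfl | rfl | rfl
        · exact h₁
        · exact h₂
        · exact h
        · exact hsX _
      have h1 := Set.ncard_le_ncard hsub (Set.toFinite _)
      rw [Set.ncard_coe_finset, Finset.card_map, hS] at h1
      have h2 := hXcard (s (c ⟨j, hj⟩))
      omega
    · intro i j hij hadj
      obtain ⟨t, hit, hjt⟩ := hX.2.1 _ _ hadj
      exact ⟨i.2, j.2, hX.mem_of_mem_of_mem (hc hij.le) (hsmin _ t hjt) (hsX _) hit⟩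
  obtain ⟨M, h1, h2, h3⟩ := hminor
  refine ⟨fun v => M (c.symm v), fun v => h1 _, fun u v huv => h2 (c.symm.injective.ne huv),
    fun u v huv => h3 _ _ (by simpa using huv)⟩

end Pathwidth

section Packing

variable {α β γ : Type*} {H : SimpleGraph β} {K : SimpleGraph γ} {G : SimpleGraph α}

lemma IsMinorModel.comp {B : β → Set γ} {M : γ → Set α} (hB : IsMinorModel H K B)
    (hM : IsMinorModel K G M) : IsMinorModel H G fun v => ⋃ p ∈ B v, M p := by
  refine ⟨fun v => ?_, fun u v huv => ?_, fun u v huv => ?_⟩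
  · obtain ⟨p, hp⟩ := induce_connected_nonempty (hB.1 v)
    obtain ⟨a, ha⟩ := induce_connected_nonempty (hM.1 p)
    have hmem : ∀ p ∈ B v, ∀ x ∈ M p, x ∈ ⋃ p ∈ B v, M p := fun p hp x hx =>
      Set.mem_biUnion hp hx
    refine induce_connected_of_forall (hmem p hp a ha) fun P hP hstep => ?_
    have hin : ∀ p ∈ B v, ∀ x ∈ M p, P x → ∀ y ∈ M p, P y := fun p hp x hx hPx =>
      forall_mem_of_induce_connected (hM.1 p) hx hPx fun y hy z hz =>
        hstep y (hmem p hp y hy) z (hmem p hp z hz)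
    have hall : ∀ p ∈ B v, ∀ x ∈ M p, P x := by
      refine forall_mem_of_induce_connected (hB.1 v) (P := fun p => ∀ x ∈ M p, P x) hp
        (hin p hp a ha hP) fun p hp p' hp' hPp hpp => ?_
      obtain ⟨x, hx, y, hy, hxy⟩ := hM.2.2 p p' hpp
      exact hin p' hp' y hy (hstep x (hmem p hp x hx) y (hmem p' hp' y hy) (hPp x hx) hxy)
    intro x hx
    obtain ⟨p, hp, hx⟩ := Set.mem_iUnion₂.1 hx
    exact hall p hp x hx
  · refine Set.disjoint_left.2 fun x hx hx' => ?_
    obtain ⟨p, hp, hx⟩ := Set.mem_iUnion₂.1 hx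
    obtain ⟨p', hp', hx'⟩ := Set.mem_iUnion₂.1 hx'
    have hne : p ≠ p' := by
      rintro rfl
      exact Set.disjoint_left.1 (hB.2.1 huv) hp hp'
    exact Set.disjoint_left.1 (hM.2.1 hne) hx hx'
  · obtain ⟨p, hp, p', hp', hpp⟩ := hB.2.2 u v huv
    obtain ⟨x, hx, y, hy, hxy⟩ := hM.2.2 p p' hpp
    exact ⟨x, Set.mem_biUnion hp hx, y, Set.mem_biUnion hp' hy, hxy⟩

lemma hasDisjointModels_of_isMinor_xi {k r : ℕ} (hH : IsMinor H (Xi r))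
    (hG : IsMinor (Xi (k * r)) G) : HasDisjointModels H G k := by
  obtain ⟨B, hB⟩ := hH
  obtain ⟨M, hM⟩ := hG
  let φ : Fin k → Fin 3 × Fin r → Fin 3 × Fin (k * r) := fun i p =>
    (p.1, finProdFinEquiv (i, p.2))
  have hφ : ∀ i i' p p', φ i p = φ i' p' → i = i' ∧ p = p' := by
    intro i i' p p' h
    have h1 := (Prod.ext_iff.1 h).1
    have h2 := Prod.ext_iff.1 (finProdFinEquiv.injective (Prod.ext_iff.1 h).2)
    exact ⟨h2.1, Prod.ext h1 h2.2⟩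
  have hMφ : ∀ i, IsMinorModel (Xi r) G fun p => M (φ i p) := by
    refine fun i => ⟨fun p => hM.1 _, fun p p' hne => hM.2.1 fun h => hne (hφ i i p p' h).2,
      fun p p' hadj => hM.2.2 _ _ ?_⟩
    obtain ⟨hne, h⟩ := xi_adj_iff.1 hadj
    refine xi_adj_iff.2 ⟨fun h => hne (hφ i i p p' h).2, ?_⟩
    simp only [φ, finProdFinEquiv_apply_val, EmbeddingLike.apply_eq_iff_eq, Prod.mk.injEq,
      true_and]
    simp only [show ∀ x y : ℕ, (x + r * i = y + r * i + 1) = (x = y + 1) from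
      fun x y => by rw [eq_iff_iff]; omega]
    exact h
  refine ⟨fun i v => ⋃ p ∈ B v, M (φ i p), fun i => hB.comp (hMφ i), fun i i' hii => ?_⟩
  simp only [Set.disjoint_iUnion_left, Set.disjoint_iUnion_right]
  exact fun u p _ v p' _ => hM.2.1 fun h => hii (hφ _ _ _ _ h).1

lemma twelve_mul_sq_le_bound {k r : ℕ} (hk : 1 ≤ k) (hr : 5 < r) :
    ((12 * (k * r * (k * r)) : ℕ) : ℝ) ≤ (k : ℝ) ^ 2 * Real.logb 2 (2 * (k : ℝ)) *
        (180 * (2 : ℝ) ^ ((r * (r - 2) : ℕ) : ℝ) - 24 * (2 : ℝ) ^ (((r * (r - 2) : ℕ) : ℝ) / 2))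
        + 6 * (2 : ℝ) ^ (((r * (r - 2) : ℕ) : ℝ) / 2) - 1 := by
  have hk' : (1 : ℝ) ≤ k := by exact_mod_cast hk
  set s : ℝ := (2 : ℝ) ^ (((r * (r - 2) : ℕ) : ℝ) / 2) with hs
  have hs1 : 1 ≤ s := Real.one_le_rpow (by norm_num) (by positivity)
  have hss : (2 : ℝ) ^ ((r * (r - 2) : ℕ) : ℝ) = s ^ 2 := by
    rw [hs, ← Real.rpow_natCast, ← Real.rpow_mul (by norm_num)]
    congr 1
    push_cast
    ring
  have hrs : (r : ℝ) ^ 2 ≤ s ^ 2 := by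
    rw [← hss, Real.rpow_natCast]
    have h1 : r ^ 2 ≤ 2 ^ (r * (r - 2)) := by
      have h2 : r < 2 ^ r := Nat.lt_two_pow_self
      calc r ^ 2 ≤ (2 ^ r) ^ 2 := Nat.pow_le_pow_left h2.le 2
        _ = 2 ^ (r * 2) := by rw [pow_mul]
        _ ≤ 2 ^ (r * (r - 2)) := Nat.pow_le_pow_right (by norm_num)
          (Nat.mul_le_mul_left r (by omega))
    exact_mod_cast h1
  have hlog : 1 ≤ Real.logb 2 (2 * (k : ℝ)) := by
    rw [Real.le_logb_iff_rpow_le (by norm_num) (by positivity)]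
    rw [Real.rpow_one]
    linarith
  rw [hss]
  have h1 : (12 : ℝ) * r ^ 2 ≤ 180 * s ^ 2 - 24 * s := by nlinarith
  have h2 : (k : ℝ) ^ 2 * (12 * r ^ 2) ≤
      (k : ℝ) ^ 2 * Real.logb 2 (2 * (k : ℝ)) * (180 * s ^ 2 - 24 * s) := by
    have h3 : (k : ℝ) ^ 2 ≤ (k : ℝ) ^ 2 * Real.logb 2 (2 * (k : ℝ)) :=
      le_mul_of_one_le_right (by positivity) hlog
    exact mul_le_mul h3 h1 (by positivity) (by positivity)
  push_cast
  nlinarith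

end Packing

/-- Let `k ≥ 1`, `r > 5`, and let `H` be a graph on `r` vertices of
pathwidth at most `2`. If `tw(G) ≥ k²·log(2k)·(180·2^{r(r−2)} − 24·2^{r(r−2)/2}) + 6·2^{r(r−2)/2} − 1`,
then `G` contains `k` pairwise disjoint models of `H`. -/
theorem tw_large_implies_packing_pw2 (k r : ℕ) (hk : 1 ≤ k) (hr : 5 < r)
    {β : Type} [Fintype β] (H : SimpleGraph β)
    (hcard : Fintype.card β = r) (hpw : pathwidth H ≤ 2)
    {α : Type} [Fintype α] (G : SimpleGraph α)
    (htw : (k : ℝ) ^ 2 * Real.logb 2 (2 * (k : ℝ)) *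
        (180 * (2 : ℝ) ^ ((r * (r - 2) : ℕ) : ℝ) - 24 * (2 : ℝ) ^ (((r * (r - 2) : ℕ) : ℝ) / 2))
        + 6 * (2 : ℝ) ^ (((r * (r - 2) : ℕ) : ℝ) / 2) - 1 ≤ (treewidth G : ℝ)) :
    HasDisjointModels H G k := by
  have h : 12 * (k * r * (k * r)) ≤ treewidth G :=
    Nat.cast_le.1 ((twelve_mul_sq_le_bound hk hr).trans htw)
  exact hasDisjointModels_of_isMinor_xi (isMinor_xi_of_pathwidth_le hcard hpw)
    (isMinor_xi_of_le_treewidth (Nat.mul_pos hk (by omega)) h)
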